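/- arXiv:2009.11285 — 2 statements merged into one kernel-verified Lean document; each statement's English description precedes it below -/
import Mathlib

section
/- Let d ≥ 1, 0 < p ≤ 2, 0 < q ≤ ∞, s > 0, α, β > 0, ν = d(1/p − 1/2)_+, and suppose s > ν. Define 𝒢 = ∪_{c ∈ [0,1]^d} U_{B_{p,q}^{s+β‖x−c‖₂^α}(Ω)}. Consider the regression model Y_i = f(X_i) + ε_i (i = 1,…,n), where (X_i)_{i=1}^n are i.i.d. uniform on Ω = [0,1]^d and (ε_i)_{i=1}^n are i.i.d. centered Gaussian N(0,σ²), σ > 0, independent of (X_i). A linear estimator is any estimator of the form f̂(x) = Σ_{i=1}^n Y_i φ_i(x, X_1,…,X_n) with measurable functions φ_i : Ω × Ω^n → ℝ. Then there exists a constant C > 0 such that for all n: inf over all linear estimators of sup_{f ∈ 𝒢} E[‖f − f̂‖²_{L²(P_X)}] ≥ C n^{−2(s−ν)/(2(s−ν)+d)}, the expectation being over the sample (X_i, Y_i)_{i=1}^n. -/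
open MeasureTheory
open scoped ENNReal NNReal Classical

noncomputable section

abbrev Euc (d : ℕ) : Type := EuclideanSpace ℝ (Fin d)

/-- The unit cube `Ω = [0,1]^d`. -/
def unitCube (d : ℕ) : Set (Euc d) := {x | ∀ i, x i ∈ Set.Icc (0 : ℝ) 1}

/-- The axis-aligned cube `[c - t, c + t]^d`. -/
def cubeAt {d : ℕ} (c : Euc d) (t : ℝ) : Set (Euc d) := {x | ∀ i, |x i - c i| ≤ t}

/-- Lebesgue measure restricted to the unit cube `Ω`. -/
def cubeMeasure (d : ℕ) : Measure (Euc d) := volume.restrict (unitCube d)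

/-- `r`-th difference `Δ_h^r f (x) = Σ_{j=0}^r (−1)^{r−j} C(r,j) f(x+jh)`, set to `0`
unless both `x ∈ Ω` and `x + r h ∈ Ω`. -/
def rDiff {d : ℕ} (r : ℕ) (h : Euc d) (f : Euc d → ℝ) (x : Euc d) : ℝ :=
  if x ∈ unitCube d ∧ x + (r : ℝ) • h ∈ unitCube d then
    ∑ j ∈ Finset.range (r + 1), (-1 : ℝ) ^ (r - j) * (r.choose j : ℝ) * f (x + (j : ℝ) • h)
  else 0

/-- `ω*_{r,p}(f,t) = sup_{‖h‖₂ ≤ t} ‖ t^{−s(·)} Δ_h^r f ‖_{L^p(Ω)}`. -/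
def omegaStar {d : ℕ} (p : ℝ≥0∞) (σ : Euc d → ℝ) (r : ℕ) (f : Euc d → ℝ) (t : ℝ) : ℝ≥0∞ :=
  ⨆ h ∈ {h : Euc d | ‖h‖ ≤ t},
    eLpNorm (fun x => t ^ (-(σ x)) * rDiff r h f x) p (cubeMeasure d)

/-- Variable-exponent Besov seminorm `|f|_{B^{s(x)}_{p,q}(Ω)}` (difference order `r`):
`(∫_0^1 ω*_{r,p}(f,t)^q dt/t)^{1/q}` for `q < ∞`, and `sup_{t>0} ω*_{r,p}(f,t)` for `q = ∞`. -/
def vBesovSemi {d : ℕ} (p q : ℝ≥0∞) (σ : Euc d → ℝ) (r : ℕ) (f : Euc d → ℝ) : ℝ≥0∞ :=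
  if q = ∞ then ⨆ t ∈ Set.Ioi (0 : ℝ), omegaStar p σ r f t
  else (∫⁻ t in Set.Ioo (0 : ℝ) 1,
        (omegaStar p σ r f t) ^ q.toReal * ENNReal.ofReal (1 / t)) ^ (1 / q.toReal)

/-- Variable-exponent Besov (quasi-)norm with explicit difference order `r`:
`‖f‖ = ‖f‖_{L^p(Ω)} + |f|_{B^{s(x)}_{p,q}(Ω)}`. -/
def vBesovNormR {d : ℕ} (p q : ℝ≥0∞) (σ : Euc d → ℝ) (r : ℕ) (f : Euc d → ℝ) : ℝ≥0∞ :=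
  eLpNorm f p (cubeMeasure d) + vBesovSemi p q σ r f

/-- The canonical difference order `r = ⌊sup_Ω s(·)⌋ + 1`. -/
def besovR {d : ℕ} (σ : Euc d → ℝ) : ℕ := ⌊sSup (σ '' unitCube d)⌋₊ + 1

/-- Variable-exponent Besov (quasi-)norm `‖f‖_{B^{s(x)}_{p,q}(Ω)}` with the canonical
difference order `r = ⌊sup_Ω s(·)⌋ + 1`. -/
def vBesovNorm {d : ℕ} (p q : ℝ≥0∞) (σ : Euc d → ℝ) (f : Euc d → ℝ) : ℝ≥0∞ :=
  vBesovNormR p q σ (besovR σ) f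

/-- The unit ball `U_{B^{s(x)}_{p,q}(Ω)}`. -/
def vBesovUnitBall (d : ℕ) (p q : ℝ≥0∞) (σ : Euc d → ℝ) : Set (Euc d → ℝ) :=
  {f | vBesovNorm p q σ f ≤ 1}

/-- log-Hölder continuity on the unit cube: there exists `c_log > 0` with
`|σ x − σ y| ≤ c_log / log (e + 1/‖x−y‖₂)` for all `x ≠ y` in `Ω`. -/
def LogHolder {d : ℕ} (σ : Euc d → ℝ) : Prop :=
  ∃ c : ℝ, 0 < c ∧ ∀ x ∈ unitCube d, ∀ y ∈ unitCube d, x ≠ y →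
    |σ x - σ y| ≤ c / Real.log (Real.exp 1 + 1 / ‖x - y‖)

/-- Univariate cardinal B-spline of degree `m`. -/
def bspline (m : ℕ) (x : ℝ) : ℝ :=
  (m.factorial : ℝ)⁻¹ *
    ∑ j ∈ Finset.range (m + 2), (-1 : ℝ) ^ j * ((m + 1).choose j : ℝ) * max (x - j) 0 ^ m

/-- Tensor-product cardinal B-spline `M_{k,j}^d(x) = M_{0,0}^d(2^k x − j)`. -/
def Mspline (d m : ℕ) (k : ℕ) (j : Fin d → ℤ) (x : Euc d) : ℝ :=
  ∏ i, bspline m ((2 : ℝ) ^ k * x i - (j i : ℝ))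

/-- `ν = d (1/p − 1/2)_+`. -/
def nuExp (d : ℕ) (p : ℝ≥0∞) : ℝ := (d : ℝ) * max (1 / p.toReal - 1 / 2) 0

open scoped ContDiff in
lemma diff_bound {d : ℕ} (r : ℕ) : ∀ (F : Type) [NormedAddCommGroup F] [NormedSpace ℝ F]
    (ψ : Euc d → F), ContDiff ℝ ∞ ψ → HasCompactSupport ψ →
    ∃ K : ℝ, 0 ≤ K ∧ ∀ h x, ‖(fwdDiff h)^[r] ψ x‖ ≤ K * ‖h‖ ^ r := by
  induction r with
  | zero =>
    intro F _ _ ψ hψ hc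
    obtain ⟨C, hC⟩ := hc.exists_bound_of_continuous hψ.continuous
    exact ⟨C, (norm_nonneg _).trans (hC 0), fun h x => by simpa using hC x⟩
  | succ r ih =>
    intro F _ _ ψ hψ hc
    obtain ⟨K, hK0, hK⟩ := ih (Euc d →L[ℝ] F) (fderiv ℝ ψ)
      (hψ.fderiv_right (by simp)) (hc.fderiv ℝ)
    refine ⟨K, hK0, fun h x => ?_⟩
    have hψd : Differentiable ℝ ψ := hψ.differentiable (by simp)
    have hd : ∀ y, HasFDerivAt ((fwdDiff h)^[r] ψ) ((fwdDiff h)^[r] (fderiv ℝ ψ) y) y := by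
      intro y
      have e : (fwdDiff h)^[r] ψ = fun y => ∑ k ∈ Finset.range (r + 1),
          ((-1 : ℤ) ^ (r - k) * (r.choose k : ℤ)) • ψ (y + k • h) := by
        funext y; exact fwdDiff_iter_eq_sum_shift h ψ r y
      rw [e, fwdDiff_iter_eq_sum_shift]
      refine HasFDerivAt.fun_sum fun k _ => ?_
      have h1 : HasFDerivAt (fun y => ψ (y + k • h)) (fderiv ℝ ψ (y + k • h)) y := by
        have := (hψd (y + k • h)).hasFDerivAt
        exact (hasFDerivAt_comp_add_right (k • h)).2 this
      have h2 := h1.const_smul (((-1 : ℤ) ^ (r - k) * (r.choose k : ℤ) : ℤ) : ℝ)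
      simp only [Int.cast_smul_eq_zsmul] at h2
      exact h2
    rw [Function.iterate_succ_apply']
    have := Convex.norm_image_sub_le_of_norm_fderiv_le (𝕜 := ℝ) (f := (fwdDiff h)^[r] ψ)
      (C := K * ‖h‖ ^ r) (s := Set.univ) (x := x) (y := x + h)
      (fun y _ => (hd y).differentiableAt) (fun y _ => by rw [(hd y).fderiv]; exact hK h y)
      convex_univ trivial trivial
    rw [fwdDiff]
    refine this.trans (le_of_eq ?_)
    rw [add_sub_cancel_left]; ring

open scoped ContDiff in
lemma diff_bound_unif {d : ℕ} (R : ℕ) (ψ : Euc d → ℝ) (hψ : ContDiff ℝ ∞ ψ)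
    (hc : HasCompactSupport ψ) :
    ∃ K : ℝ, 0 < K ∧ ∀ r ≤ R, ∀ h x, ‖(fwdDiff h)^[r] ψ x‖ ≤ K ∧
      ‖(fwdDiff h)^[r] ψ x‖ ≤ K * ‖h‖ ^ r := by
  obtain ⟨C, hC⟩ := hc.exists_bound_of_continuous hψ.continuous
  have hC0 : 0 ≤ C := (norm_nonneg _).trans (hC 0)
  choose K hK0 hK using fun r => diff_bound (d := d) r ℝ ψ hψ hc
  have h2 : ∀ r h x, ‖(fwdDiff h)^[r] ψ x‖ ≤ 2 ^ r * C := by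
    intro r h
    induction r with
    | zero => intro x; simpa using hC x
    | succ r ih =>
      intro x
      rw [Function.iterate_succ_apply', fwdDiff]
      have := norm_sub_le ((fwdDiff h)^[r] ψ (x + h)) ((fwdDiff h)^[r] ψ x)
      have h3 := ih (x + h)
      have h4 := ih x
      rw [pow_succ]; linarith
  refine ⟨1 + 2 ^ R * C + ∑ r ∈ Finset.range (R + 1), K r, ?_, ?_⟩
  · have := Finset.sum_nonneg (s := Finset.range (R + 1)) (fun r _ => hK0 r)
    positivity
  · intro r hr h x
    have hs := Finset.sum_nonneg (s := Finset.range (R + 1)) (fun r _ => hK0 r)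
    have hs' : K r ≤ ∑ r ∈ Finset.range (R + 1), K r :=
      Finset.single_le_sum (f := K) (fun r _ => hK0 r) (by simp; omega)
    have h3 : (2:ℝ) ^ r * C ≤ 2 ^ R * C := by
      gcongr; norm_num
    have h0 : 0 ≤ 2 ^ R * C := by positivity
    constructor
    · linarith [h2 r h x]
    · refine (hK r h x).trans ?_
      gcongr
      linarith

lemma gauss_lintegral (n : ℕ) (a : ℝ) (b : Fin n → ℝ) (v : NNReal) :
    ∫⁻ ε, ‖a - ∑ i, ε i * b i‖ₑ ^ 2
      ∂(Measure.pi fun _ : Fin n => ProbabilityTheory.gaussianReal 0 v)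
      = ENNReal.ofReal (a ^ 2 + v * ∑ i, b i ^ 2) := by
  set P := Measure.pi fun _ : Fin n => ProbabilityTheory.gaussianReal 0 v with hP
  set X : Fin n → (Fin n → ℝ) → ℝ := fun i ε => ε i * b i with hX
  have hid : MemLp (id : ℝ → ℝ) 2 (ProbabilityTheory.gaussianReal 0 v) :=
    ProbabilityTheory.memLp_id_gaussianReal 2
  have hmp : ∀ i : Fin n, MeasurePreserving (Function.eval i) P
      (ProbabilityTheory.gaussianReal 0 v) := fun i =>
    measurePreserving_eval (fun _ : Fin n => ProbabilityTheory.gaussianReal 0 v) i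
  have hXL : ∀ i, MemLp (X i) 2 P := fun i =>
    (hid.comp_measurePreserving (hmp i)).mul_const (b i)
  have hXi : ∀ i, ∫ ε, X i ε ∂P = 0 := by
    intro i
    have h1 : ∫ ε, X i ε ∂P = ∫ y, y * b i ∂(ProbabilityTheory.gaussianReal 0 v) := by
      rw [← (hmp i).map_eq, integral_map (measurable_pi_apply i).aemeasurable
        (by fun_prop)]
    rw [h1, integral_mul_const, ProbabilityTheory.integral_id_gaussianReal, zero_mul]
  have hXv : ∀ i, ProbabilityTheory.variance (X i) P = v * b i ^ 2 := by
    intro i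
    have h1 : ProbabilityTheory.variance (X i) P =
        ProbabilityTheory.variance (fun y => y * b i) (ProbabilityTheory.gaussianReal 0 v) := by
      rw [← (hmp i).map_eq, ProbabilityTheory.variance_map (by fun_prop)
        (hmp i).measurable.aemeasurable]
      rfl
    have h2 := ProbabilityTheory.variance_id_gaussianReal (μ := 0) (v := v)
    rw [h1, ProbabilityTheory.variance_mul_const]
    change ProbabilityTheory.variance id _ * _ = _
    rw [h2]
  have hind : ProbabilityTheory.iIndepFun X P := by
    exact ProbabilityTheory.iIndepFun_pi (X := fun i (y : ℝ) => y * b i) (fun i => by fun_prop)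
  have hSL : MemLp (∑ i, X i) 2 P := memLp_finsetSum' _ (fun i _ => hXL i)
  have hS0 : ∫ ε, (∑ i, X i) ε ∂P = 0 := by
    simp only [Finset.sum_apply]
    rw [integral_finsetSum _ (fun i _ => (hXL i).integrable (by norm_num))]
    simp [hXi]
  have hSv : ∫ ε, ((∑ i, X i) ^ 2) ε ∂P = v * ∑ i, b i ^ 2 := by
    have h1 := ProbabilityTheory.IndepFun.variance_sum (s := Finset.univ) (fun i _ => hXL i)
      (fun i _ j _ hij => hind.indepFun hij)
    rw [ProbabilityTheory.variance_eq_sub hSL, hS0] at h1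
    simp only [hXv] at h1
    rw [Finset.mul_sum, ← h1]; ring
  have hSi : Integrable (fun ε => (∑ i, X i) ε) P := hSL.integrable (by norm_num)
  have hS2 : Integrable (fun ε => ((∑ i, X i) ^ 2) ε) P := hSL.integrable_sq
  have e : ∀ ε : Fin n → ℝ, ‖a - ∑ i, ε i * b i‖ₑ ^ 2 =
      ENNReal.ofReal (a ^ 2 - 2 * a * (∑ i, X i) ε + ((∑ i, X i) ^ 2) ε) := by
    intro ε
    rw [Real.enorm_eq_ofReal_abs, ← ENNReal.ofReal_pow (abs_nonneg _), sq_abs]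
    simp only [hX, Pi.pow_apply, Finset.sum_apply]
    congr 1; ring
  simp_rw [e]
  have hI : Integrable (fun ε => a ^ 2 - 2 * a * (∑ i, X i) ε + ((∑ i, X i) ^ 2) ε) P :=
    ((integrable_const _).sub (hSi.const_mul _)).add hS2
  rw [← ofReal_integral_eq_lintegral_ofReal hI]
  · congr 1
    have hI1 : Integrable (fun ε => a ^ 2 - 2 * a * (∑ i, X i) ε) P :=
      (integrable_const _).sub (hSi.const_mul _)
    rw [integral_add hI1 hS2, integral_sub (integrable_const _) (hSi.const_mul _), integral_const_mul, hS0, hSv]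
    simp
  · refine Filter.Eventually.of_forall fun ε => ?_
    simp only [Pi.zero_apply, Pi.pow_apply]
    nlinarith [sq_nonneg (a - (∑ i, X i) ε)]

lemma ennreal_sq_sum {ι : Type*} (s : Finset ι) (f : ι → ℝ≥0∞) :
    (∑ i ∈ s, f i) ^ 2 ≤ (s.card : ℝ≥0∞) * ∑ i ∈ s, f i ^ 2 := by
  have := ENNReal.rpow_sum_le_const_mul_sum_rpow s f (p := 2) (by norm_num)
  have e : (2 : ℝ) - 1 = 1 := by norm_num
  rw [e, ENNReal.rpow_one] at this
  simpa using this

lemma ennreal_sq_add (a b : ℝ≥0∞) : (a + b) ^ 2 ≤ 2 * a ^ 2 + 2 * b ^ 2 := by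
  have := ennreal_sq_sum (Finset.univ : Finset (Fin 2)) ![a, b]
  simpa [mul_add] using this

lemma pathwise {E ι : Type*} [MeasurableSpace E] [Fintype ι] [Nonempty ι] (μ : Measure E) (n : ℕ)
    (f : ι → E → ℝ) (hf : ∀ j, Measurable (f j)) (φ : Fin n → E → ℝ) (hφ : ∀ i, Measurable (φ i))
    (y : Fin n → E) (A : ℝ) (hA : 0 ≤ A) (hy : ∀ i, ∑ j, |f j (y i)| ≤ A) (v : NNReal)
    (hv : A ^ 2 * n ≤ v * (Fintype.card ι : ℝ) ^ 2)
    (T : ℝ≥0∞) (hT : ∀ j, T ≤ eLpNorm (f j) 2 μ) :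
    (Fintype.card ι : ℝ≥0∞) * T ^ 2 ≤ 2 * ∑ j, (eLpNorm (fun x => f j x - ∑ i, f j (y i) * φ i x) 2 μ ^ 2
      + v * ∑ i, eLpNorm (φ i) 2 μ ^ 2) := by
  set b : ι → ℝ≥0∞ := fun j => eLpNorm (fun x => f j x - ∑ i, f j (y i) * φ i x) 2 μ with hb
  set Φ : Fin n → ℝ≥0∞ := fun i => eLpNorm (φ i) 2 μ with hΦ
  set N : ℝ≥0∞ := (Fintype.card ι : ℝ≥0∞) with hN
  have hN0 : N ≠ 0 := by simp [hN]
  have hNt : N ≠ ∞ := by simp [hN]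
  have h1 : ∀ j, T ≤ b j + ∑ i, ENNReal.ofReal |f j (y i)| * Φ i := by
    intro j
    refine (hT j).trans ?_
    have e : f j = (fun x => f j x - ∑ i, f j (y i) * φ i x) +
        ∑ i, (fun x => f j (y i) * φ i x) := by
      funext x; simp
    have hm : ∀ i, Measurable (fun x => f j (y i) * φ i x) := fun i => (hφ i).const_mul _
    calc eLpNorm (f j) 2 μ ≤ b j + eLpNorm (∑ i, (fun x => f j (y i) * φ i x)) 2 μ := by
          conv_lhs => rw [e]
          refine eLpNorm_add_le ?_ ?_ (by norm_num)
          · exact ((hf j).sub (Finset.measurable_sum _ fun i _ => hm i)).aestronglyMeasurable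
          · exact Finset.aestronglyMeasurable_sum _ fun i _ => (hm i).aestronglyMeasurable
      _ ≤ _ := by
          gcongr
          refine (eLpNorm_sum_le (fun i _ => (hm i).aestronglyMeasurable) (by norm_num)).trans ?_
          refine Finset.sum_le_sum fun i _ => ?_
          have := eLpNorm_const_smul (f j (y i)) (φ i) 2 μ
          rw [Real.enorm_eq_ofReal_abs] at this
          exact le_of_eq this
  have h2 : N * T ≤ ∑ j, b j + ENNReal.ofReal A * ∑ i, Φ i := by
    calc N * T = ∑ _j : ι, T := by simp [hN]
      _ ≤ ∑ j, (b j + ∑ i, ENNReal.ofReal |f j (y i)| * Φ i) := Finset.sum_le_sum fun j _ => h1 j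
      _ = ∑ j, b j + ∑ i, (∑ j, ENNReal.ofReal |f j (y i)|) * Φ i := by
          rw [Finset.sum_add_distrib, Finset.sum_comm]
          simp_rw [Finset.sum_mul]
      _ ≤ _ := by
          rw [Finset.mul_sum]
          gcongr with i
          rw [← ENNReal.ofReal_sum_of_nonneg (fun _ _ => abs_nonneg _)]
          exact ENNReal.ofReal_le_ofReal (hy i)
  have hv' : ENNReal.ofReal A ^ 2 * n ≤ v * N ^ 2 := by
    have := ENNReal.ofReal_le_ofReal hv
    rw [ENNReal.ofReal_mul (by positivity), ENNReal.ofReal_mul (by positivity),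
      ENNReal.ofReal_pow hA, ENNReal.ofReal_natCast, ENNReal.ofReal_pow (by positivity),
      ENNReal.ofReal_natCast, ENNReal.ofReal_coe_nnreal] at this
    exact this
  have h3 : N * (N * T ^ 2) ≤ N * (2 * ∑ j, (b j ^ 2 + v * ∑ i, Φ i ^ 2)) := by
    calc N * (N * T ^ 2) = (N * T) ^ 2 := by ring
      _ ≤ (∑ j, b j + ENNReal.ofReal A * ∑ i, Φ i) ^ 2 := by gcongr
      _ ≤ 2 * (∑ j, b j) ^ 2 + 2 * (ENNReal.ofReal A * ∑ i, Φ i) ^ 2 := ennreal_sq_add _ _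
      _ ≤ 2 * (N * ∑ j, b j ^ 2) + 2 * (ENNReal.ofReal A ^ 2 * (n * ∑ i, Φ i ^ 2)) := by
          rw [mul_pow]
          have q1 := ennreal_sq_sum Finset.univ b
          have q2 := ennreal_sq_sum Finset.univ Φ
          rw [Finset.card_univ] at q1 q2
          rw [Fintype.card_fin] at q2
          gcongr
      _ = 2 * (N * ∑ j, b j ^ 2) + 2 * ((ENNReal.ofReal A ^ 2 * n) * ∑ i, Φ i ^ 2) := by ring
      _ ≤ 2 * (N * ∑ j, b j ^ 2) + 2 * ((v * N ^ 2) * ∑ i, Φ i ^ 2) := by gcongr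
      _ = _ := by
          rw [Finset.sum_add_distrib, Finset.sum_const, Finset.card_univ, nsmul_eq_mul]
          ring
  exact (ENNReal.mul_le_mul_iff_right hN0 hNt).1 h3

lemma eLpNorm_two_sq {E : Type*} [MeasurableSpace E] (μ : Measure E) (g : E → ℝ) :
    eLpNorm g 2 μ ^ 2 = ∫⁻ x, ‖g x‖ₑ ^ 2 ∂μ := by
  have := eLpNorm_nnreal_pow_eq_lintegral (f := g) (μ := μ) (p := 2) (by norm_num)
  simpa using this

lemma risk_eq {E : Type*} [MeasurableSpace E] (μ : Measure E) [SFinite μ] (n : ℕ)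
    (P : Measure (Fin n → E)) [SFinite P]
    (f : E → ℝ) (hf : Measurable f) (φ : Fin n → E → (Fin n → E) → ℝ)
    (hφ : ∀ i, Measurable fun z : E × (Fin n → E) => φ i z.1 z.2) (v : NNReal) :
    ∫⁻ w, (eLpNorm (fun x => f x - ∑ i, (f (w.1 i) + w.2 i) * φ i x w.1) 2 μ) ^ 2
      ∂(P.prod (Measure.pi fun _ : Fin n => ProbabilityTheory.gaussianReal 0 v)) =
    ∫⁻ y, (eLpNorm (fun x => f x - ∑ i, f (y i) * φ i x y) 2 μ ^ 2
      + v * ∑ i, eLpNorm (fun x => φ i x y) 2 μ ^ 2) ∂P := by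
  set G := Measure.pi fun _ : Fin n => ProbabilityTheory.gaussianReal 0 v with hG
  simp_rw [eLpNorm_two_sq]
  have hm : Measurable (fun z : ((Fin n → E) × (Fin n → ℝ)) × E =>
      ‖f z.2 - ∑ i, (f (z.1.1 i) + z.1.2 i) * φ i z.2 z.1.1‖ₑ ^ 2) := by
    have h1 : ∀ i, Measurable (fun z : ((Fin n → E) × (Fin n → ℝ)) × E => φ i z.2 z.1.1) :=
      fun i => (hφ i).comp (measurable_snd.prodMk (measurable_fst.comp measurable_fst))
    fun_prop
  rw [lintegral_prod _ (Measurable.lintegral_prod_right' hm).aemeasurable]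
  refine lintegral_congr fun y => ?_
  rw [lintegral_lintegral_swap]
  · have e : ∀ x, ∫⁻ ε, ‖f x - ∑ i, (f (y i) + ε i) * φ i x y‖ₑ ^ 2 ∂G =
        ‖f x - ∑ i, f (y i) * φ i x y‖ₑ ^ 2 + v * ∑ i, ‖φ i x y‖ₑ ^ 2 := by
      intro x
      have := gauss_lintegral n (f x - ∑ i, f (y i) * φ i x y) (fun i => φ i x y) v
      have e2 : ∀ ε : Fin n → ℝ, f x - ∑ i, (f (y i) + ε i) * φ i x y =
          (f x - ∑ i, f (y i) * φ i x y) - ∑ i, ε i * φ i x y := by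
        intro ε
        simp_rw [add_mul]
        rw [Finset.sum_add_distrib]; ring
      simp_rw [e2]
      rw [this, ENNReal.ofReal_add (by positivity)
        (by positivity), ENNReal.ofReal_mul (by positivity),
        ENNReal.ofReal_sum_of_nonneg (fun _ _ => by positivity), ENNReal.ofReal_coe_nnreal]
      simp_rw [Real.enorm_eq_ofReal_abs, ← ENNReal.ofReal_pow (abs_nonneg _), sq_abs]
    simp_rw [e]
    have h1 : ∀ i, Measurable (fun x => φ i x y) := fun i => (hφ i).comp measurable_prodMk_right
    rw [lintegral_add_left (by fun_prop), lintegral_const_mul _ (by fun_prop),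
      lintegral_finsetSum _ (by fun_prop)]
  · have : Measurable (fun z : (Fin n → ℝ) × E => ((y, z.1), z.2)) := by fun_prop
    exact (hm.comp this).aemeasurable

lemma exists_risk {E ι : Type*} [MeasurableSpace E] [Fintype ι] [Nonempty ι]
    (μ : Measure E) [IsProbabilityMeasure μ] (n : ℕ)
    (f : ι → E → ℝ) (hf : ∀ j, Measurable (f j)) (φ : Fin n → E → (Fin n → E) → ℝ)
    (hφ : ∀ i, Measurable fun z : E × (Fin n → E) => φ i z.1 z.2)
    (A : ℝ) (hA : 0 ≤ A) (hy : ∀ y, ∑ j, |f j y| ≤ A) (v : NNReal)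
    (hv : A ^ 2 * n ≤ v * (Fintype.card ι : ℝ) ^ 2)
    (T : ℝ≥0∞) (hT : ∀ j, T ≤ eLpNorm (f j) 2 μ) (S : ℝ≥0∞)
    (hS : ∀ j, ∫⁻ w, (eLpNorm (fun x => f j x - ∑ i, (f j (w.1 i) + w.2 i) * φ i x w.1) 2 μ) ^ 2
      ∂((Measure.pi fun _ : Fin n => μ).prod
        (Measure.pi fun _ : Fin n => ProbabilityTheory.gaussianReal 0 v)) ≤ S) :
    T ^ 2 ≤ 2 * S := by
  set N : ℝ≥0∞ := (Fintype.card ι : ℝ≥0∞) with hN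
  have hN0 : N ≠ 0 := by simp [hN]
  have hNt : N ≠ ∞ := by simp [hN]
  set P := (Measure.pi fun _ : Fin n => μ)
  have h1 : N * T ^ 2 ≤ N * (2 * S) := by
    calc N * T ^ 2 = ∫⁻ _, N * T ^ 2 ∂P := by simp
      _ ≤ ∫⁻ y, 2 * ∑ j, (eLpNorm (fun x => f j x - ∑ i, f j (y i) * φ i x y) 2 μ ^ 2
            + v * ∑ i, eLpNorm (fun x => φ i x y) 2 μ ^ 2) ∂P := by
          refine lintegral_mono fun y => ?_
          exact pathwise μ n f hf (fun i x => φ i x y)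
            (fun i => (hφ i).comp measurable_prodMk_right) y A hA (fun i => hy (y i)) v hv T hT
      _ = 2 * ∑ j, ∫⁻ y, (eLpNorm (fun x => f j x - ∑ i, f j (y i) * φ i x y) 2 μ ^ 2
            + v * ∑ i, eLpNorm (fun x => φ i x y) 2 μ ^ 2) ∂P := by
          have hmm : ∀ j, Measurable (fun y =>
              (eLpNorm (fun x => f j x - ∑ i, f j (y i) * φ i x y) 2 μ ^ 2
              + v * ∑ i, eLpNorm (fun x => φ i x y) 2 μ ^ 2)) := by
            intro j
            simp_rw [eLpNorm_two_sq]
            have q1 : ∀ i, Measurable (fun z : (Fin n → E) × E => φ i z.2 z.1) :=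
              fun i => (hφ i).comp measurable_swap
            have q2 : Measurable (fun z : (Fin n → E) × E =>
                ‖f j z.2 - ∑ i, f j (z.1 i) * φ i z.2 z.1‖ₑ ^ 2) := by
              have := hf j
              fun_prop
            have q3 : ∀ i, Measurable (fun z : (Fin n → E) × E => ‖φ i z.2 z.1‖ₑ ^ 2) := by
              intro i; have := q1 i; fun_prop
            refine (Measurable.lintegral_prod_right' q2).add (Measurable.const_mul ?_ _)
            exact Finset.measurable_sum _ fun i _ => Measurable.lintegral_prod_right' (q3 i)
          rw [lintegral_const_mul _ (Finset.measurable_sum _ fun j _ => hmm j),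
            lintegral_finsetSum _ (fun j _ => hmm j)]
      _ ≤ 2 * ∑ _j : ι, S := by
          gcongr with j
          rw [← risk_eq μ n P (f j) (hf j) φ hφ v]
          exact hS j
      _ = N * (2 * S) := by simp [hN]; ring
  exact (ENNReal.mul_le_mul_iff_right hN0 hNt).1 h1

/-- A fixed smooth bump: equal to `1` on the ball of radius `1/4`, supported in the ball of
radius `1/2`. -/
def psiBump (d : ℕ) : ContDiffBump (0 : Euc d) := ⟨1 / 4, 1 / 2, by norm_num, by norm_num⟩

lemma psi_le_one {d : ℕ} (x : Euc d) : psiBump d x ≤ 1 := (psiBump d).le_one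
lemma psi_nonneg {d : ℕ} (x : Euc d) : 0 ≤ psiBump d x := (psiBump d).nonneg
lemma psi_supp {d : ℕ} (x : Euc d) (h : psiBump d x ≠ 0) : ‖x‖ < 1 / 2 := by
  have : x ∈ Function.support (psiBump d) := h
  rw [ContDiffBump.support_eq] at this
  simpa [psiBump] using this
lemma psi_one {d : ℕ} (x : Euc d) (h : ‖x‖ ≤ 1 / 4) : psiBump d x = 1 := by
  apply (psiBump d).one_of_mem_closedBall
  simpa [psiBump] using h

/-- The rescaled bump. -/
def fBump {d : ℕ} (a L : ℝ) (c : Euc d) (x : Euc d) : ℝ := a * psiBump d (L • (x - c))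

lemma fBump_supp {d : ℕ} (a L : ℝ) (hL : 0 < L) (c : Euc d) (x : Euc d) (h : fBump a L c x ≠ 0) :
    ‖x - c‖ < L⁻¹ / 2 := by
  have h1 := psi_supp _ (right_ne_zero_of_mul h)
  rw [norm_smul, Real.norm_of_nonneg hL.le] at h1
  have : ‖x - c‖ = L⁻¹ * (L * ‖x - c‖) := by field_simp
  rw [this]
  have := mul_lt_mul_of_pos_left h1 (inv_pos.2 hL)
  linarith

lemma fBump_cont {d : ℕ} (a L : ℝ) (c : Euc d) : Continuous (fBump a L c) := by
  unfold fBump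
  exact continuous_const.mul ((psiBump d).continuous.comp (by fun_prop))

lemma sum_fBump {d : ℕ} (a L : ℝ) (c : Euc d) (r : ℕ) (h x : Euc d) :
    ∑ j ∈ Finset.range (r + 1), (-1 : ℝ) ^ (r - j) * (r.choose j : ℝ) *
      fBump a L c (x + (j : ℝ) • h) = a * (fwdDiff (L • h))^[r] (psiBump d) (L • (x - c)) := by
  rw [fwdDiff_iter_eq_sum_shift, Finset.mul_sum]
  refine Finset.sum_congr rfl fun j _ => ?_
  have e : L • (x + (j : ℝ) • h - c) = L • (x - c) + j • L • h := by
    rw [← Nat.cast_smul_eq_nsmul ℝ]; module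
  rw [fBump, e, zsmul_eq_mul]
  push_cast
  ring

lemma rDiff_fBump_zero {d : ℕ} (a L : ℝ) (hL : 0 < L) (c : Euc d) (r : ℕ) (h x : Euc d)
    (hx : x ∉ ⋃ j ∈ Finset.range (r + 1), Metric.closedBall (c - (j : ℝ) • h) L⁻¹) :
    rDiff r h (fBump a L c) x = 0 := by
  unfold rDiff
  split_ifs
  · refine Finset.sum_eq_zero fun j hj => ?_
    have : fBump a L c (x + (j : ℝ) • h) = 0 := by
      by_contra hne
      have h1 := fBump_supp a L hL c _ hne
      apply hx
      simp only [Set.mem_iUnion]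
      refine ⟨j, hj, ?_⟩
      rw [Metric.mem_closedBall, dist_eq_norm]
      have e : x - (c - (j : ℝ) • h) = x + (j : ℝ) • h - c := by abel
      rw [e]
      have := inv_pos.2 hL
      linarith
    rw [this, mul_zero]
  · rfl

lemma rDiff_fBump_le {d : ℕ} (a L : ℝ) (ha : 0 ≤ a) (hL : 0 < L) (c : Euc d) (r R : ℕ) (hr : r ≤ R)
    (K : ℝ) (hK : 0 < K) (hKd : ∀ r ≤ R, ∀ h x : Euc d, ‖(fwdDiff h)^[r] (psiBump d) x‖ ≤ K ∧
      ‖(fwdDiff h)^[r] (psiBump d) x‖ ≤ K * ‖h‖ ^ r) (h x : Euc d) :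
    |rDiff r h (fBump a L c) x| ≤ a * K ∧
    |rDiff r h (fBump a L c) x| ≤ a * (K * (L * ‖h‖) ^ r) := by
  unfold rDiff
  split_ifs
  · rw [sum_fBump, abs_mul, abs_of_nonneg ha]
    have h1 := hKd r hr (L • h) (L • (x - c))
    rw [norm_smul, Real.norm_of_nonneg hL.le, Real.norm_eq_abs] at h1
    exact ⟨mul_le_mul_of_nonneg_left h1.1 ha, mul_le_mul_of_nonneg_left h1.2 ha⟩
  · simp only [abs_zero]; constructor <;> positivity

lemma weight_aux (α β t ρ b : ℝ) (hα : 0 < α) (hβ : 0 < β) (ht : 0 < t) (ht1 : t ≤ 1) (hρ : 0 ≤ ρ)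
    (hb : 0 ≤ b) (hρb : ρ ≤ b * t) : t ^ (-(β * ρ ^ α)) ≤ Real.exp (β * b ^ α / α) := by
  rw [Real.rpow_def_of_pos ht]
  apply Real.exp_le_exp.2
  have h1 := Real.log_le_rpow_div (x := t⁻¹) (by positivity) hα
  rw [Real.log_inv, Real.inv_rpow ht.le] at h1
  have h0 : 0 ≤ -Real.log t := by linarith [Real.log_nonpos ht.le ht1]
  have h2 : ρ ^ α ≤ b ^ α * t ^ α := by
    rw [← Real.mul_rpow hb ht.le]
    exact Real.rpow_le_rpow hρ hρb hα.le
  have htα : 0 < t ^ α := Real.rpow_pos_of_pos ht _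
  calc Real.log t * -(β * ρ ^ α) = β * (-Real.log t) * ρ ^ α := by ring
    _ ≤ β * (-Real.log t) * (b ^ α * t ^ α) := by gcongr
    _ ≤ β * ((t ^ α)⁻¹ / α) * (b ^ α * t ^ α) := by gcongr
    _ = _ := by field_simp

lemma weight1 (s α β t δ ρ b κ : ℝ) (r : ℕ) (hα : 0 < α) (hβ : 0 < β) (ht : 0 < t)
    (htδ : t ≤ δ) (hδ : δ ≤ 1)
    (hρ : 0 ≤ ρ) (hb : 0 ≤ b) (hρb : ρ ≤ b * δ) (hr : κ ≤ r - (s + β * ρ ^ α)) :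
    t ^ (-(s + β * ρ ^ α)) * (t / δ) ^ r ≤
      Real.exp (β * b ^ α / α) * δ ^ (-s) * (t / δ) ^ κ := by
  have hδ0 : 0 < δ := ht.trans_le htδ
  have hu : 0 < t / δ := by positivity
  have hu1 : t / δ ≤ 1 := (div_le_one hδ0).2 htδ
  have e : t = δ * (t / δ) := by field_simp
  have h1 := weight_aux α β δ ρ b hα hβ hδ0 hδ hρ hb hρb
  have h2 : (t / δ) ^ ((r : ℝ) - (s + β * ρ ^ α)) ≤ (t / δ) ^ κ :=
    Real.rpow_le_rpow_of_exponent_ge hu hu1 hr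
  have e1 : t ^ (-(s + β * ρ ^ α)) = δ ^ (-s) * δ ^ (-(β * ρ ^ α)) *
      (t / δ) ^ (-(s + β * ρ ^ α)) := by
    conv_lhs => rw [e]
    rw [Real.mul_rpow hδ0.le hu.le, ← Real.rpow_add hδ0, neg_add]
  have e2 : (t / δ) ^ (-(s + β * ρ ^ α)) * (t / δ) ^ r = (t / δ) ^ ((r : ℝ) - (s + β * ρ ^ α)) := by
    rw [← Real.rpow_natCast, ← Real.rpow_add hu]; congr 1; ring
  rw [e1, mul_assoc, e2]
  have h3 : 0 < δ ^ (-s) := Real.rpow_pos_of_pos hδ0 _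
  calc δ ^ (-s) * δ ^ (-(β * ρ ^ α)) * (t / δ) ^ ((r : ℝ) - (s + β * ρ ^ α))
      ≤ δ ^ (-s) * Real.exp (β * b ^ α / α) * (t / δ) ^ κ := by gcongr
    _ = _ := by ring

lemma weight2 (s α β t δ ρ b κ : ℝ) (hα : 0 < α) (hβ : 0 < β) (hδ0 : 0 < δ)
    (htδ : δ ≤ t) (ht1 : t ≤ 1)
    (hρ : 0 ≤ ρ) (hb : 0 ≤ b) (hρb : ρ ≤ b * t) (hκ : κ ≤ s) :
    t ^ (-(s + β * ρ ^ α)) ≤ Real.exp (β * b ^ α / α) * δ ^ (-s) * (t / δ) ^ (-κ) := by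
  have ht : 0 < t := hδ0.trans_le htδ
  have hu1 : 1 ≤ t / δ := (one_le_div hδ0).2 htδ
  have hu : 0 < t / δ := by positivity
  have h1 := weight_aux α β t ρ b hα hβ ht ht1 hρ hb hρb
  have h2 : (t / δ) ^ (-s) ≤ (t / δ) ^ (-κ) :=
    Real.rpow_le_rpow_of_exponent_le hu1 (by linarith)
  have e : t = δ * (t / δ) := by field_simp
  have e1 : t ^ (-(s + β * ρ ^ α)) = δ ^ (-s) * (t / δ) ^ (-s) * t ^ (-(β * ρ ^ α)) := by
    rw [neg_add, Real.rpow_add ht, ← Real.mul_rpow hδ0.le hu.le, ← e]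
  rw [e1]
  have h3 : 0 < δ ^ (-s) := Real.rpow_pos_of_pos hδ0 _
  calc δ ^ (-s) * (t / δ) ^ (-s) * t ^ (-(β * ρ ^ α))
      ≤ δ ^ (-s) * (t / δ) ^ (-κ) * Real.exp (β * b ^ α / α) := by gcongr
    _ = _ := by ring

lemma weight3 (s α β t δ ρ b : ℝ) (hs : 0 < s) (hα : 0 < α) (hβ : 0 < β) (hδ0 : 0 < δ)
    (hδ : δ ≤ 1) (ht1 : 1 ≤ t) (hρ : 0 ≤ ρ) (hb : 0 ≤ b) :
    t ^ (-(s + β * ρ ^ α)) ≤ Real.exp (β * b ^ α / α) * δ ^ (-s) := by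
  have h1 : t ^ (-(s + β * ρ ^ α)) ≤ 1 := by
    apply Real.rpow_le_one_of_one_le_of_nonpos ht1
    have : 0 ≤ β * ρ ^ α := by positivity
    linarith
  have h2 : 1 ≤ Real.exp (β * b ^ α / α) := Real.one_le_exp (by positivity)
  have h3 : 1 ≤ δ ^ (-s) := Real.one_le_rpow_of_pos_of_le_one_of_nonpos hδ0 hδ (by linarith)
  nlinarith

/-- The profile of the modulus of smoothness of a bump. -/
def gProf (δ e t : ℝ) : ℝ := if t ≤ δ then (t / δ) ^ e else (t / δ) ^ (-e)

lemma gProf_integral (δ e : ℝ) (hδ : 0 < δ) (he : 0 < e) :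
    ∫⁻ t in Set.Ioo (0 : ℝ) 1, ENNReal.ofReal (gProf δ e t * (1 / t)) ≤
      ENNReal.ofReal (2 / e) := by
  have hsub : Set.Ioo (0 : ℝ) 1 ⊆ Set.Ioc 0 δ ∪ Set.Ioi δ := by
    intro t ht
    rcases le_or_gt t δ with h | h
    · exact Or.inl ⟨ht.1, h⟩
    · exact Or.inr h
  have h1 : ∫⁻ t in Set.Ioc (0 : ℝ) δ, ENNReal.ofReal (gProf δ e t * (1 / t)) =
      ENNReal.ofReal (1 / e) := by
    have : ∫⁻ t in Set.Ioc (0 : ℝ) δ, ENNReal.ofReal (gProf δ e t * (1 / t)) =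
        ∫⁻ t in Set.Ioc (0 : ℝ) δ, ENNReal.ofReal (δ ^ (-e) * t ^ (e - 1)) := by
      refine setLIntegral_congr_fun measurableSet_Ioc fun t ht => ?_
      simp only [gProf, if_pos ht.2]
      rw [Real.div_rpow ht.1.le hδ.le, Real.rpow_neg hδ.le, Real.rpow_sub_one ht.1.ne']
      congr 1; field_simp
    rw [this, ← ofReal_integral_eq_lintegral_ofReal]
    · congr 1
      rw [integral_const_mul, ← intervalIntegral.integral_of_le hδ.le,
        integral_rpow (Or.inl (by linarith))]
      rw [sub_add_cancel, Real.zero_rpow he.ne', Real.rpow_neg hδ.le]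
      have := Real.rpow_pos_of_pos hδ e
      field_simp
      simp
    · refine Integrable.const_mul ?_ _
      exact (integrableOn_Ioc_iff_integrableOn_Ioo).2
        ((intervalIntegral.integrableOn_Ioo_rpow_iff hδ).2 (by linarith))
    · refine (ae_restrict_mem measurableSet_Ioc).mono fun t ht => ?_
      have := ht.1
      simp only [Pi.zero_apply]
      positivity
  have h2 : ∫⁻ t in Set.Ioi δ, ENNReal.ofReal (gProf δ e t * (1 / t)) =
      ENNReal.ofReal (1 / e) := by
    have : ∫⁻ t in Set.Ioi δ, ENNReal.ofReal (gProf δ e t * (1 / t)) =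
        ∫⁻ t in Set.Ioi δ, ENNReal.ofReal (δ ^ e * t ^ (-e - 1)) := by
      refine setLIntegral_congr_fun measurableSet_Ioi fun t ht => ?_
      have ht0 : 0 < t := hδ.trans ht
      simp only [gProf, if_neg (not_le.2 (Set.mem_Ioi.1 ht))]
      rw [Real.div_rpow ht0.le hδ.le, Real.rpow_neg hδ.le, Real.rpow_sub_one ht0.ne']
      congr 1; field_simp
    rw [this, ← ofReal_integral_eq_lintegral_ofReal]
    · congr 1
      rw [integral_const_mul, integral_Ioi_rpow_of_lt (by linarith) hδ]
      rw [sub_add_cancel, Real.rpow_neg hδ.le]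
      have := Real.rpow_pos_of_pos hδ e
      field_simp
    · exact Integrable.const_mul (integrableOn_Ioi_rpow_of_lt (by linarith) hδ) _
    · refine (ae_restrict_mem measurableSet_Ioi).mono fun t ht => ?_
      have : 0 < t := hδ.trans ht
      simp only [Pi.zero_apply]
      positivity
  calc _ ≤ ∫⁻ t in Set.Ioc 0 δ ∪ Set.Ioi δ, ENNReal.ofReal (gProf δ e t * (1 / t)) :=
        lintegral_mono_set hsub
    _ ≤ _ := lintegral_union_le _ _ _
    _ = _ := by
        rw [h1, h2, ← ENNReal.ofReal_add (by positivity) (by positivity)]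
        congr 1; ring

lemma gProf_nonneg (δ e t : ℝ) (hδ : 0 < δ) (ht : 0 < t) : 0 ≤ gProf δ e t := by
  unfold gProf; split_ifs <;> positivity

lemma gProf_le_one (δ e t : ℝ) (hδ : 0 < δ) (ht : 0 < t) (he : 0 ≤ e) : gProf δ e t ≤ 1 := by
  unfold gProf; split_ifs with h
  · exact Real.rpow_le_one (by positivity) ((div_le_one hδ).2 h) he
  · exact Real.rpow_le_one_of_one_le_of_nonpos ((one_le_div hδ).2 (not_le.1 h).le) (by linarith)

lemma gProf_rpow (δ e q t : ℝ) (hδ : 0 < δ) (ht : 0 < t) :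
    gProf δ e t ^ q = gProf δ (e * q) t := by
  unfold gProf; split_ifs
  · rw [Real.rpow_mul (by positivity)]
  · rw [← Real.rpow_mul (by positivity)]; congr 1; ring

lemma eLp_bound {d : ℕ} (p : ℝ≥0∞) (μ : Measure (Euc d)) (g : Euc d → ℝ) (S : Set (Euc d)) (M : ℝ)
    (h1 : ∀ x ∈ S, |g x| ≤ M) (h2 : ∀ x ∉ S, g x = 0) (hM : 0 ≤ M) :
    eLpNorm g p μ ≤ ENNReal.ofReal M * μ S ^ (1 / p.toReal) := by
  have : ∀ x, ‖g x‖ ≤ S.indicator (fun _ => M) x := by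
    intro x
    by_cases hx : x ∈ S
    · simpa [hx] using h1 x hx
    · simp [hx, h2 x hx]
  refine (eLpNorm_mono_real this).trans ((eLpNorm_indicator_const_le M p).trans ?_)
  rw [Real.enorm_eq_ofReal_abs, abs_of_nonneg hM]

/-- Volume of the Euclidean unit ball. -/
def volB (d : ℕ) : ℝ := (volume (Metric.ball (0 : Euc d) 1)).toReal

lemma volB_pos (d : ℕ) : 0 < volB d :=
  ENNReal.toReal_pos (Metric.measure_ball_pos _ _ one_pos).ne' measure_ball_lt_top.ne

lemma vol_closedBall {d : ℕ} (c : Euc d) (δ : ℝ) (hδ : 0 ≤ δ) :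
    volume (Metric.closedBall c δ) = ENNReal.ofReal (volB d * δ ^ d) := by
  rw [Measure.addHaar_closedBall _ _ hδ, mul_comm (volB d), ENNReal.ofReal_mul (by positivity),
    volB, ENNReal.ofReal_toReal measure_ball_lt_top.ne]
  simp

lemma meas_S {d : ℕ} (c h : Euc d) (δ : ℝ) (hδ : 0 ≤ δ) (r R : ℕ) (hr : r ≤ R) :
    cubeMeasure d (⋃ j ∈ Finset.range (r + 1), Metric.closedBall (c - (j : ℝ) • h) δ) ≤
      ENNReal.ofReal ((R + 1) * volB d * δ ^ d) := by
  have hV := volB_pos d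
  refine (Measure.restrict_apply_le _ _).trans ((measure_biUnion_finset_le _ _).trans ?_)
  simp_rw [vol_closedBall _ δ hδ]
  rw [Finset.sum_const, Finset.card_range, nsmul_eq_mul, ← ENNReal.ofReal_natCast,
    ← ENNReal.ofReal_mul (by positivity)]
  apply ENNReal.ofReal_le_ofReal
  push_cast
  rw [mul_assoc]
  gcongr

lemma meas_S_rpow {d : ℕ} (c h : Euc d) (δ : ℝ) (hδ : 0 < δ) (r R : ℕ) (hr : r ≤ R) (P : ℝ)
    (hP : 0 < P) :
    cubeMeasure d (⋃ j ∈ Finset.range (r + 1), Metric.closedBall (c - (j : ℝ) • h) δ) ^ (1 / P) ≤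
      ENNReal.ofReal (((R + 1) * volB d) ^ (1 / P) * δ ^ (d / P)) := by
  have hV := volB_pos d
  refine (ENNReal.rpow_le_rpow (meas_S c h δ hδ.le r R hr) (by positivity)).trans ?_
  rw [ENNReal.ofReal_rpow_of_nonneg (by positivity) (by positivity),
    Real.mul_rpow (by positivity) (by positivity), ← Real.rpow_natCast, ← Real.rpow_mul hδ.le,
    mul_one_div]

lemma norm_sub_cube {d : ℕ} {x c : Euc d} (hx : x ∈ unitCube d) (hc : c ∈ unitCube d) :
    ‖x - c‖ ≤ Real.sqrt d := by
  rw [EuclideanSpace.norm_eq]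
  apply Real.sqrt_le_sqrt
  calc ∑ i, ‖(x - c) i‖ ^ 2 ≤ ∑ _i : Fin d, (1 : ℝ) := by
        refine Finset.sum_le_sum fun i _ => ?_
        have h1 := hx i
        have h2 := hc i
        rw [Real.norm_eq_abs, sq_abs, PiLp.sub_apply]
        nlinarith [h1.1, h1.2, h2.1, h2.2]
    _ = d := by simp

lemma besovR_bounds {d : ℕ} (s α β : ℝ) (hα : 0 < α) (hβ : 0 < β) {c : Euc d}
    (hc : c ∈ unitCube d) :
    ⌊s⌋₊ + 1 ≤ besovR (fun x : Euc d => s + β * ‖x - c‖ ^ α) ∧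
    besovR (fun x : Euc d => s + β * ‖x - c‖ ^ α) ≤ ⌊s + β * Real.sqrt d ^ α⌋₊ + 1 := by
  unfold besovR
  have hub : ∀ y ∈ (fun x : Euc d => s + β * ‖x - c‖ ^ α) '' unitCube d,
      y ≤ s + β * Real.sqrt d ^ α := by
    rintro y ⟨x, hx, rfl⟩
    have := norm_sub_cube hx hc
    simp only
    gcongr
  constructor
  · gcongr
    refine le_csSup ⟨_, hub⟩ ⟨c, hc, ?_⟩
    simp [Real.zero_rpow hα.ne']
  · gcongr
    exact csSup_le ⟨_, c, hc, rfl⟩ hub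

lemma pointwise_bump {d : ℕ} (s α β : ℝ) (hs : 0 < s) (hα : 0 < α) (hβ : 0 < β)
    (r R : ℕ) (hr : r ≤ R)
    (K : ℝ) (hK : 0 < K) (hKd : ∀ r ≤ R, ∀ h x : Euc d, ‖(fwdDiff h)^[r] (psiBump d) x‖ ≤ K ∧
      ‖(fwdDiff h)^[r] (psiBump d) x‖ ≤ K * ‖h‖ ^ r)
    (a L κ : ℝ) (ha : 0 ≤ a) (hL : 1 ≤ L) (c : Euc d)
    (hκs : κ ≤ s) (hκ : 0 ≤ κ) (hκr : κ ≤ r - (s + β * ((R + 1) * L⁻¹) ^ α))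
    (t : ℝ) (ht : 0 < t) (h x : Euc d) (hh : ‖h‖ ≤ t)
    (hx : x ∈ ⋃ j ∈ Finset.range (r + 1), Metric.closedBall (c - (j : ℝ) • h) L⁻¹) :
    |t ^ (-(s + β * ‖x - c‖ ^ α)) * rDiff r h (fBump a L c) x| ≤
      a * K * Real.exp (β * (R + 1 : ℝ) ^ α / α) * L⁻¹ ^ (-s) *
        (if t ≤ 1 then gProf L⁻¹ κ t else 1) := by
  have hL0 : 0 < L := by linarith
  set δ := L⁻¹ with hδ
  have hδ0 : 0 < δ := inv_pos.2 hL0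
  have hδ1 : δ ≤ 1 := inv_le_one_of_one_le₀ hL
  obtain ⟨b1, b2⟩ := rDiff_fBump_le a L ha hL0 c r R hr K hK hKd h x
  have hρ0 := norm_nonneg (x - c)
  have hR0 : (0 : ℝ) ≤ R + 1 := by positivity
  have hρ : ‖x - c‖ ≤ δ + R * t := by
    simp only [Set.mem_iUnion] at hx
    obtain ⟨j, hj, hx⟩ := hx
    rw [Metric.mem_closedBall, dist_eq_norm] at hx
    have e : x - c = (x - (c - (j : ℝ) • h)) - (j : ℝ) • h := by abel
    have hjR : (j : ℝ) ≤ R := by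
      have := Finset.mem_range.1 hj
      exact_mod_cast (by omega : j ≤ R)
    calc ‖x - c‖ ≤ ‖x - (c - (j : ℝ) • h)‖ + ‖(j : ℝ) • h‖ := by rw [e]; exact norm_sub_le _ _
      _ ≤ δ + R * t := by
          rw [norm_smul, Real.norm_of_nonneg (by positivity)]
          gcongr
  have hw0 : 0 < t ^ (-(s + β * ‖x - c‖ ^ α)) := Real.rpow_pos_of_pos ht _
  rw [abs_mul, abs_of_pos hw0]
  rcases le_or_gt t 1 with ht1 | ht1
  · rw [if_pos ht1, gProf]
    split_ifs with htδ
    · have hρb : ‖x - c‖ ≤ (R + 1) * δ := by nlinarith [Nat.cast_nonneg (α := ℝ) R]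
      have hpow : ‖x - c‖ ^ α ≤ ((R + 1) * δ) ^ α := Real.rpow_le_rpow hρ0 hρb hα.le
      have hw := weight1 s α β t δ ‖x - c‖ (R + 1) κ r hα hβ ht htδ hδ1 hρ0 hR0 hρb
        (by nlinarith)
      have hd : |rDiff r h (fBump a L c) x| ≤ a * (K * (t / δ) ^ r) := by
        refine b2.trans ?_
        have : L * ‖h‖ ≤ t / δ := by
          rw [hδ, div_inv_eq_mul, mul_comm]; gcongr
        gcongr
      calc _ ≤ t ^ (-(s + β * ‖x - c‖ ^ α)) * (a * (K * (t / δ) ^ r)) := by gcongr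
        _ = a * K * (t ^ (-(s + β * ‖x - c‖ ^ α)) * (t / δ) ^ r) := by ring
        _ ≤ a * K * (Real.exp (β * (R + 1 : ℝ) ^ α / α) * δ ^ (-s) * (t / δ) ^ κ) := by gcongr
        _ = _ := by ring
    · have htδ' := (not_le.1 htδ).le
      have hρb : ‖x - c‖ ≤ (R + 1) * t := by linarith
      have hw := weight2 s α β t δ ‖x - c‖ (R + 1) κ hα hβ hδ0 htδ' ht1 hρ0 hR0 hρb hκs
      calc _ ≤ t ^ (-(s + β * ‖x - c‖ ^ α)) * (a * K) := by gcongr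
        _ = a * K * t ^ (-(s + β * ‖x - c‖ ^ α)) := by ring
        _ ≤ a * K * (Real.exp (β * (R + 1 : ℝ) ^ α / α) * δ ^ (-s) * (t / δ) ^ (-κ)) := by gcongr
        _ = _ := by ring
  · rw [if_neg (not_le.2 ht1)]
    have hw := weight3 s α β t δ ‖x - c‖ (R + 1) hs hα hβ hδ0 hδ1 ht1.le hρ0 hR0
    calc _ ≤ t ^ (-(s + β * ‖x - c‖ ^ α)) * (a * K) := by gcongr
      _ = a * K * t ^ (-(s + β * ‖x - c‖ ^ α)) := by ring
      _ ≤ a * K * (Real.exp (β * (R + 1 : ℝ) ^ α / α) * δ ^ (-s)) := by gcongr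
      _ = _ := by ring

lemma omega_bump {d : ℕ} (p : ℝ≥0∞) (hp : 0 < p.toReal) (s α β : ℝ) (hs : 0 < s) (hα : 0 < α)
    (hβ : 0 < β) (r R : ℕ) (hr : r ≤ R)
    (K : ℝ) (hK : 0 < K) (hKd : ∀ r ≤ R, ∀ h x : Euc d, ‖(fwdDiff h)^[r] (psiBump d) x‖ ≤ K ∧
      ‖(fwdDiff h)^[r] (psiBump d) x‖ ≤ K * ‖h‖ ^ r)
    (c1 L κ : ℝ) (hc1 : 0 ≤ c1) (hL : 1 ≤ L) (c : Euc d)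
    (hκs : κ ≤ s) (hκ : 0 ≤ κ) (hκr : κ ≤ r - (s + β * ((R + 1) * L⁻¹) ^ α))
    (t : ℝ) (ht : 0 < t) :
    omegaStar p (fun x => s + β * ‖x - c‖ ^ α) r
      (fBump (c1 * L⁻¹ ^ (s - d / p.toReal)) L c) t ≤
      ENNReal.ofReal (c1 * (K * Real.exp (β * (R + 1 : ℝ) ^ α / α) *
        ((R + 1) * volB d) ^ (1 / p.toReal)) * (if t ≤ 1 then gProf L⁻¹ κ t else 1)) := by
  have hL0 : 0 < L := by linarith
  have hδ0 : 0 < L⁻¹ := inv_pos.2 hL0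
  have hV := volB_pos d
  have hg : 0 ≤ (if t ≤ 1 then gProf L⁻¹ κ t else 1) := by
    split_ifs
    · exact gProf_nonneg _ _ _ hδ0 ht
    · norm_num
  unfold omegaStar
  refine iSup₂_le fun h hh => ?_
  refine (eLp_bound p _ _ _ _ (pointwise_bump s α β hs hα hβ r R hr K hK hKd
    (c1 * L⁻¹ ^ (s - d / p.toReal)) L κ (by positivity) hL c hκs hκ hκr t ht h · hh) ?_ ?_).trans ?_
  · intro x hx
    rw [rDiff_fBump_zero _ L hL0 c r h x hx, mul_zero]
  · positivity
  · refine (mul_le_mul_right (meas_S_rpow c h L⁻¹ hδ0 r R hr p.toReal hp) _).trans ?_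
    rw [← ENNReal.ofReal_mul (by positivity)]
    apply ENNReal.ofReal_le_ofReal
    have e : L⁻¹ ^ (s - d / p.toReal) * L⁻¹ ^ (-s) * L⁻¹ ^ (d / p.toReal) = 1 := by
      rw [← Real.rpow_add hδ0, ← Real.rpow_add hδ0]
      have e0 : s - d / p.toReal + -s + d / p.toReal = 0 := by ring
      rw [e0, Real.rpow_zero]
    apply le_of_eq
    generalize (if t ≤ 1 then gProf L⁻¹ κ t else 1) = g at *
    calc _ = c1 * (K * Real.exp (β * (R + 1 : ℝ) ^ α / α) *
        ((R + 1) * volB d) ^ (1 / p.toReal)) * g *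
        (L⁻¹ ^ (s - d / p.toReal) * L⁻¹ ^ (-s) * L⁻¹ ^ (d / p.toReal)) := by ring
      _ = _ := by rw [e, mul_one]

lemma lp_bump {d : ℕ} (p : ℝ≥0∞) (hp : 0 < p.toReal) (s : ℝ) (hs : 0 < s) (R : ℕ)
    (c1 L : ℝ) (hc1 : 0 ≤ c1) (hL : 1 ≤ L) (c : Euc d) :
    eLpNorm (fBump (c1 * L⁻¹ ^ (s - d / p.toReal)) L c) p (cubeMeasure d) ≤
      ENNReal.ofReal (c1 * ((R + 1) * volB d) ^ (1 / p.toReal)) := by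
  have hL0 : 0 < L := by linarith
  have hδ0 : 0 < L⁻¹ := inv_pos.2 hL0
  have hV := volB_pos d
  have ha : 0 ≤ c1 * L⁻¹ ^ (s - d / p.toReal) := by positivity
  refine (eLp_bound p _ _ (⋃ j ∈ Finset.range (0 + 1), Metric.closedBall (c - (j : ℝ) • (0 : Euc d)) L⁻¹)
    (c1 * L⁻¹ ^ (s - d / p.toReal)) ?_ ?_ ha).trans ?_
  · intro x _
    rw [fBump, abs_mul, abs_of_nonneg ha, abs_of_nonneg (psi_nonneg _)]
    exact mul_le_of_le_one_right ha (psi_le_one _)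
  · intro x hx
    by_contra hne
    apply hx
    have := fBump_supp _ L hL0 c x hne
    simp only [Set.mem_iUnion]
    refine ⟨0, by simp, ?_⟩
    rw [Metric.mem_closedBall, dist_eq_norm]
    simp only [smul_zero, sub_zero]
    linarith
  · refine (mul_le_mul_right (meas_S_rpow c 0 L⁻¹ hδ0 0 R (Nat.zero_le _) p.toReal hp) _).trans ?_
    rw [← ENNReal.ofReal_mul (by positivity)]
    apply ENNReal.ofReal_le_ofReal
    have e : L⁻¹ ^ (s - d / p.toReal) * L⁻¹ ^ (d / p.toReal) = L⁻¹ ^ s := by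
      rw [← Real.rpow_add hδ0]
      simp
    have h1 : L⁻¹ ^ s ≤ 1 := Real.rpow_le_one hδ0.le (inv_le_one_of_one_le₀ hL) hs.le
    calc _ = c1 * ((R + 1) * volB d) ^ (1 / p.toReal) *
          (L⁻¹ ^ (s - d / p.toReal) * L⁻¹ ^ (d / p.toReal)) := by ring
      _ ≤ _ := by
        rw [e]
        exact mul_le_of_le_one_right (by positivity) h1

lemma semi_bump {d : ℕ} (p q : ℝ≥0∞) (hq : 0 < q) (σ : Euc d → ℝ) (r : ℕ) (f : Euc d → ℝ)
    (c1 W δ κ : ℝ) (hc1 : 0 ≤ c1) (hW : 0 ≤ W) (hδ : 0 < δ) (hκ : 0 < κ)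
    (hω : ∀ t, 0 < t → omegaStar p σ r f t ≤
      ENNReal.ofReal (c1 * W * (if t ≤ 1 then gProf δ κ t else 1))) :
    vBesovSemi p q σ r f ≤
      ENNReal.ofReal (c1 * (W * (1 + (2 / (κ * q.toReal)) ^ (1 / q.toReal)))) := by
  unfold vBesovSemi
  split_ifs with hqt
  · refine iSup₂_le fun t ht => (hω t ht).trans (ENNReal.ofReal_le_ofReal ?_)
    have h1 : (if t ≤ 1 then gProf δ κ t else 1) ≤ 1 := by
      split_ifs
      · exact gProf_le_one _ _ _ hδ ht hκ.le
      · exact le_rfl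
    have h2 : 0 ≤ (2 / (κ * q.toReal)) ^ (1 / q.toReal) := by positivity
    calc _ ≤ c1 * W * 1 := by gcongr
      _ ≤ c1 * W * (1 + (2 / (κ * q.toReal)) ^ (1 / q.toReal)) := by gcongr; linarith
      _ = _ := by ring
  · have hq0 : 0 < q.toReal := ENNReal.toReal_pos hq.ne' hqt
    have h1 : (∫⁻ t in Set.Ioo (0 : ℝ) 1,
        (omegaStar p σ r f t) ^ q.toReal * ENNReal.ofReal (1 / t)) ≤
        ENNReal.ofReal ((c1 * W) ^ q.toReal) * ENNReal.ofReal (2 / (κ * q.toReal)) := by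
      calc _ ≤ ∫⁻ t in Set.Ioo (0 : ℝ) 1, ENNReal.ofReal ((c1 * W) ^ q.toReal) *
            ENNReal.ofReal (gProf δ (κ * q.toReal) t * (1 / t)) := by
            refine setLIntegral_mono' measurableSet_Ioo fun t ht => ?_
            have h := hω t ht.1
            rw [if_pos ht.2.le] at h
            have hg := gProf_nonneg δ κ t hδ ht.1
            have hg' := gProf_nonneg δ (κ * q.toReal) t hδ ht.1
            calc _ ≤ ENNReal.ofReal (c1 * W * gProf δ κ t) ^ q.toReal * ENNReal.ofReal (1 / t) := by
                  gcongr
              _ = _ := by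
                  rw [ENNReal.ofReal_rpow_of_nonneg (by positivity) hq0.le,
                    Real.mul_rpow (by positivity) hg, gProf_rpow _ _ _ _ hδ ht.1,
                    ENNReal.ofReal_mul (by positivity), ENNReal.ofReal_mul hg', mul_assoc]
        _ = ENNReal.ofReal ((c1 * W) ^ q.toReal) * ∫⁻ t in Set.Ioo (0 : ℝ) 1,
            ENNReal.ofReal (gProf δ (κ * q.toReal) t * (1 / t)) :=
            lintegral_const_mul' _ _ ENNReal.ofReal_ne_top
        _ ≤ _ := by
            gcongr
            exact gProf_integral δ (κ * q.toReal) hδ (by positivity)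
    refine (ENNReal.rpow_le_rpow h1 (by positivity)).trans ?_
    rw [← ENNReal.ofReal_mul (by positivity), ENNReal.ofReal_rpow_of_nonneg (by positivity)
      (by positivity)]
    apply ENNReal.ofReal_le_ofReal
    rw [Real.mul_rpow (by positivity) (by positivity), ← Real.rpow_mul (by positivity),
      mul_one_div_cancel hq0.ne', Real.rpow_one, ← mul_assoc]
    gcongr
    linarith

lemma bump_mem (d : ℕ) (p q : ℝ≥0∞) (hp : 0 < p.toReal) (hq : 0 < q)
    (s α β : ℝ) (hs : 0 < s) (hα : 0 < α) (hβ : 0 < β) :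
    ∃ c0 : ℝ, 0 < c0 ∧ ∃ M0 : ℕ, 1 ≤ M0 ∧ ∀ L : ℝ, (M0 : ℝ) ≤ L → ∀ c ∈ unitCube d,
      ∀ c1 : ℝ, 0 ≤ c1 → c1 ≤ c0 → fBump (c1 * L⁻¹ ^ (s - d / p.toReal)) L c ∈
        vBesovUnitBall d p q (fun x : Euc d => s + β * ‖x - c‖ ^ α) := by
  set R : ℕ := ⌊s + β * Real.sqrt d ^ α⌋₊ + 1 with hR
  obtain ⟨K, hK, hKd⟩ := diff_bound_unif R (psiBump d) (psiBump d).contDiff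
    (psiBump d).hasCompactSupport
  have hV := volB_pos d
  set η : ℝ := (⌊s⌋₊ : ℝ) + 1 - s with hη
  have hη0 : 0 < η := by have := Nat.lt_floor_add_one s; linarith
  set κ : ℝ := min (η / 2) s with hκd
  have hκ : 0 < κ := lt_min (by linarith) hs
  set B : ℝ := ((R + 1) * volB d) ^ (1 / p.toReal) with hB
  have hB0 : 0 < B := by positivity
  set W : ℝ := K * Real.exp (β * (R + 1 : ℝ) ^ α / α) * B with hWd
  have hW : 0 < W := by positivity
  set Q : ℝ := 1 + (2 / (κ * q.toReal)) ^ (1 / q.toReal) with hQ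
  have hQ0 : 0 < Q := by positivity
  set z : ℝ := (η / (2 * β)) ^ (1 / α) with hz
  have hz0 : 0 < z := by positivity
  refine ⟨(B + W * Q)⁻¹, by positivity, ⌈(R + 1) / z⌉₊ + 1, by omega, ?_⟩
  intro L hL c hc c1 hc1 hc10
  push_cast at hL
  have hLz : (R + 1) / z ≤ L := by linarith [Nat.le_ceil ((R + 1) / z)]
  have hL1 : 1 ≤ L := by linarith [Nat.cast_nonneg (α := ℝ) ⌈((R : ℝ) + 1) / z⌉₊]
  have hL0 : 0 < L := by linarith
  obtain ⟨hr1, hr2⟩ := besovR_bounds (d := d) s α β hα hβ hc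
  set r := besovR (fun x : Euc d => s + β * ‖x - c‖ ^ α) with hr
  have hsmall : β * ((R + 1) * L⁻¹) ^ α ≤ η / 2 := by
    have h1 : (R + 1) * L⁻¹ ≤ z := by
      rw [← div_eq_mul_inv, div_le_iff₀ hL0]
      rwa [div_le_iff₀ hz0, mul_comm] at hLz
    have h2 : ((R + 1) * L⁻¹) ^ α ≤ z ^ α := Real.rpow_le_rpow (by positivity) h1 hα.le
    have h3 : z ^ α = η / (2 * β) := by
      rw [hz, ← Real.rpow_mul (by positivity), one_div_mul_cancel hα.ne', Real.rpow_one]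
    rw [h3] at h2
    calc _ ≤ β * (η / (2 * β)) := by gcongr
      _ = η / 2 := by field_simp
  have hκr : κ ≤ r - (s + β * ((R + 1) * L⁻¹) ^ α) := by
    have h1 : (⌊s⌋₊ : ℝ) + 1 ≤ r := by exact_mod_cast hr1
    have h2 : κ ≤ η / 2 := min_le_left _ _
    linarith
  have hω := omega_bump (d := d) p hp s α β hs hα hβ r R hr2 K hK hKd c1 L κ hc1 hL1 c
    (min_le_right _ _) hκ.le hκr
  have h1 := semi_bump p q hq _ r _ c1 W L⁻¹ κ hc1 hW.le (inv_pos.2 hL0) hκ hω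
  have h2 := lp_bump (d := d) p hp s hs R c1 L hc1 hL1 c
  change vBesovNormR p q _ r _ ≤ 1
  unfold vBesovNormR
  refine (add_le_add h2 h1).trans ?_
  rw [← ENNReal.ofReal_add (by positivity) (by positivity)]
  rw [← ENNReal.ofReal_one]
  apply ENNReal.ofReal_le_ofReal
  calc _ = c1 * (B + W * Q) := by ring
    _ ≤ (B + W * Q)⁻¹ * (B + W * Q) := by gcongr
    _ = 1 := inv_mul_cancel₀ (by positivity)

lemma volume_unitCube (d : ℕ) : volume (unitCube d) = 1 := by
  have h := (EuclideanSpace.volume_preserving_symm_measurableEquiv_toLp (Fin d)).measure_preimage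
    (s := Set.Icc (0 : Fin d → ℝ) 1) measurableSet_Icc.nullMeasurableSet
  have e : (MeasurableEquiv.toLp 2 (Fin d → ℝ)).symm ⁻¹' Set.Icc (0 : Fin d → ℝ) 1 =
      unitCube d := by
    ext x
    simp only [Set.mem_preimage, Set.mem_Icc, Pi.le_def, unitCube, Set.mem_ofPred_eq]
    exact ⟨fun h i => ⟨h.1 i, h.2 i⟩, fun h => ⟨fun i => (h i).1, fun i => (h i).2⟩⟩
  rw [e, Real.volume_Icc_pi] at h
  simpa using h

instance cubeMeasure_prob (d : ℕ) : IsProbabilityMeasure (cubeMeasure d) :=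
  ⟨by rw [cubeMeasure, Measure.restrict_apply_univ, volume_unitCube]⟩

/-- Centres of the cells of the regular grid with `M ^ d` cells. -/
def gridC {d M : ℕ} (j : Fin d → Fin M) : Euc d :=
  WithLp.toLp 2 fun i => ((j i : ℕ) + 1 / 2 : ℝ) * (M : ℝ)⁻¹

lemma gridC_bounds {d M : ℕ} (j : Fin d → Fin M) (i : Fin d) :
    (M : ℝ)⁻¹ / 2 ≤ gridC j i ∧ gridC j i ≤ 1 - (M : ℝ)⁻¹ / 2 := by
  have hM : (0 : ℝ) < M := by
    have := (j i).2
    exact_mod_cast (by omega : 0 < M)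
  have hj : ((j i : ℕ) : ℝ) + 1 ≤ M := by exact_mod_cast (j i).2
  have hj0 : (0 : ℝ) ≤ ((j i : ℕ) : ℝ) := Nat.cast_nonneg _
  have hi : (0 : ℝ) < (M : ℝ)⁻¹ := inv_pos.2 hM
  have e : (M : ℝ) * (M : ℝ)⁻¹ = 1 := mul_inv_cancel₀ hM.ne'
  simp only [gridC]
  constructor <;> nlinarith

lemma gridC_mem {d M : ℕ} (j : Fin d → Fin M) : gridC j ∈ unitCube d := by
  intro i
  have hi : (0 : ℝ) ≤ (M : ℝ)⁻¹ := by positivity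
  have := gridC_bounds j i
  constructor <;> linarith

lemma grid_ball_sub {d M : ℕ} (j : Fin d → Fin M) :
    Metric.closedBall (gridC j) ((M : ℝ)⁻¹ / 4) ⊆ unitCube d := by
  intro x hx i
  rw [Metric.mem_closedBall, dist_eq_norm] at hx
  have h1 := (PiLp.norm_apply_le (x - gridC j) i).trans hx
  rw [PiLp.sub_apply, Real.norm_eq_abs, abs_le] at h1
  have hi : (0 : ℝ) ≤ (M : ℝ)⁻¹ := by positivity
  have := gridC_bounds j i
  constructor <;> linarith [h1.1, h1.2]

lemma grid_unique {d M : ℕ} (hM : 0 < M) (a : ℝ) (j k : Fin d → Fin M) (y : Euc d)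
    (hj : fBump a (M : ℝ) (gridC j) y ≠ 0) (hk : fBump a (M : ℝ) (gridC k) y ≠ 0) : j = k := by
  have hM' : (0 : ℝ) < M := by exact_mod_cast hM
  have h1 := fBump_supp a M hM' _ _ hj
  have h2 := fBump_supp a M hM' _ _ hk
  funext i
  have h3 := (PiLp.norm_apply_le (y - gridC j) i).trans_lt h1
  have h4 := (PiLp.norm_apply_le (y - gridC k) i).trans_lt h2
  rw [PiLp.sub_apply, Real.norm_eq_abs, abs_lt] at h3 h4
  have hi : (0 : ℝ) < (M : ℝ)⁻¹ := inv_pos.2 hM'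
  have h5 : ((j i : ℕ) : ℝ) - (k i : ℕ) < 1 := by
    have : (((j i : ℕ) : ℝ) - (k i : ℕ)) * (M : ℝ)⁻¹ < 1 * (M : ℝ)⁻¹ := by
      simp only [gridC] at h3 h4
      nlinarith [h3.1, h3.2, h4.1, h4.2]
    exact lt_of_mul_lt_mul_right this hi.le
  have h6 : ((k i : ℕ) : ℝ) - (j i : ℕ) < 1 := by
    have : (((k i : ℕ) : ℝ) - (j i : ℕ)) * (M : ℝ)⁻¹ < 1 * (M : ℝ)⁻¹ := by
      simp only [gridC] at h3 h4
      nlinarith [h3.1, h3.2, h4.1, h4.2]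
    exact lt_of_mul_lt_mul_right this hi.le
  have h7 : (j i : ℕ) < (k i : ℕ) + 1 := by
    have : ((j i : ℕ) : ℝ) < (k i : ℕ) + 1 := by linarith
    exact_mod_cast this
  have h8 : (k i : ℕ) < (j i : ℕ) + 1 := by
    have : ((k i : ℕ) : ℝ) < (j i : ℕ) + 1 := by linarith
    exact_mod_cast this
  exact Fin.ext (by omega)

lemma grid_sum_le {d M : ℕ} (hM : 0 < M) (a : ℝ) (ha : 0 ≤ a) (y : Euc d) :
    ∑ j : Fin d → Fin M, |fBump a (M : ℝ) (gridC j) y| ≤ a := by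
  by_cases h : ∃ j : Fin d → Fin M, fBump a (M : ℝ) (gridC j) y ≠ 0
  · obtain ⟨j, hj⟩ := h
    rw [Finset.sum_eq_single j]
    · rw [fBump, abs_mul, abs_of_nonneg ha, abs_of_nonneg (psi_nonneg _)]
      exact mul_le_of_le_one_right ha (psi_le_one _)
    · intro k _ hkj
      rw [abs_eq_zero]
      by_contra hk
      exact hkj (grid_unique hM a k j y hk hj)
    · simp
  · push Not at h
    simp [h, ha]

lemma grid_norm {d M : ℕ} (hM : 0 < M) (a : ℝ) (ha : 0 ≤ a) (j : Fin d → Fin M) :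
    ENNReal.ofReal (a ^ 2 * (volB d * ((M : ℝ)⁻¹ / 4) ^ d)) ≤
      eLpNorm (fBump a (M : ℝ) (gridC j)) 2 (cubeMeasure d) ^ 2 := by
  have hM' : (0 : ℝ) < M := by exact_mod_cast hM
  rw [eLpNorm_two_sq]
  refine le_trans ?_ (setLIntegral_le_lintegral (Metric.closedBall (gridC j) ((M : ℝ)⁻¹ / 4)) _)
  have h1 : ∫⁻ _ in Metric.closedBall (gridC j) ((M : ℝ)⁻¹ / 4), ENNReal.ofReal (a ^ 2)
      ∂(cubeMeasure d) = ENNReal.ofReal (a ^ 2 * (volB d * ((M : ℝ)⁻¹ / 4) ^ d)) := by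
    rw [setLIntegral_const, cubeMeasure, Measure.restrict_apply Metric.isClosed_closedBall.measurableSet,
      Set.inter_eq_left.2 (grid_ball_sub j), vol_closedBall _ _ (by positivity),
      ENNReal.ofReal_mul (sq_nonneg a)]
  rw [← h1]
  refine setLIntegral_mono' Metric.isClosed_closedBall.measurableSet fun x hx => ?_
  rw [Metric.mem_closedBall, dist_eq_norm] at hx
  have h2 : ‖(M : ℝ) • (x - gridC j)‖ ≤ 1 / 4 := by
    rw [norm_smul, Real.norm_of_nonneg hM'.le]
    calc (M : ℝ) * ‖x - gridC j‖ ≤ M * ((M : ℝ)⁻¹ / 4) := by gcongr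
      _ = 1 / 4 := by field_simp
  rw [fBump, psi_one _ h2, mul_one, Real.enorm_eq_ofReal_abs, abs_of_nonneg ha,
    ENNReal.ofReal_pow ha]

/-- Theorem 5.2. Lower bound for linear estimators on
`𝒢 = ⋃_{c ∈ [0,1]^d} U_{B^{s+β‖x−c‖₂^α}_{p,q}(Ω)}` under uniform design `P_X` and Gaussian
noise: every linear estimator `f̂(x) = Σ_i Y_i φ_i(x, X^n)` has worst-case risk at least
`C n^{−2(s−ν)/(2(s−ν)+d)}`. -/
theorem linear_estimator_lower_bound (d : ℕ) (hd : 1 ≤ d)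
    (p q : ℝ≥0∞) (hp : 0 < p) (hp2 : p ≤ 2) (hq : 0 < q)
    (s α β : ℝ) (hs : 0 < s) (hα : 0 < α) (hβ : 0 < β)
    (hsν : nuExp d p < s) (σnoise : NNReal) (hσ : 0 < σnoise) :
    ∃ C : ℝ, 0 < C ∧ ∀ n : ℕ,
      ∀ φ : Fin n → Euc d → (Fin n → Euc d) → ℝ,
        (∀ i, Measurable fun z : Euc d × (Fin n → Euc d) => φ i z.1 z.2) →
        ENNReal.ofReal (C * (n : ℝ) ^
            (-(2 * (s - nuExp d p) / (2 * (s - nuExp d p) + d)))) ≤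
          ⨆ f ∈ ⋃ c ∈ unitCube d,
              vBesovUnitBall d p q (fun x : Euc d => s + β * ‖x - c‖ ^ α),
            ∫⁻ w, (eLpNorm
                (fun x => f x - ∑ i, (f (w.1 i) + w.2 i) * φ i x w.1)
                2 (cubeMeasure d)) ^ 2
              ∂((Measure.pi fun _ : Fin n => cubeMeasure d).prod
                (Measure.pi fun _ : Fin n =>
                  ProbabilityTheory.gaussianReal 0 (σnoise ^ 2))) := by
  have hpt : p ≠ ∞ := ne_top_of_le_ne_top (by norm_num) hp2
  have hP : 0 < p.toReal := ENNReal.toReal_pos hp.ne' hpt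
  have hP2 : p.toReal ≤ 2 := by
    have := ENNReal.toReal_mono (by norm_num) hp2
    simpa using this
  have hν : nuExp d p = d / p.toReal - d / 2 := by
    have h1 : 1 / 2 ≤ 1 / p.toReal := one_div_le_one_div_of_le hP hP2
    rw [nuExp, max_eq_left (by linarith)]
    ring
  set γ : ℝ := 2 * (s - nuExp d p) with hγ
  have hγ0 : 0 < γ := by rw [hγ]; linarith
  have hd0 : (0 : ℝ) < d := by exact_mod_cast hd
  obtain ⟨c0, hc0, M0, hM0, hmem⟩ := bump_mem d p q hP hq s α β hs hα hβ
  have hV := volB_pos d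
  have hσ' : (0 : ℝ) < σnoise := hσ
  set c1 : ℝ := min c0 σnoise with hc1d
  have hc1 : 0 < c1 := lt_min hc0 hσ'
  have hM0r : (0 : ℝ) < M0 := by exact_mod_cast hM0
  refine ⟨c1 ^ 2 * volB d * (1 / 4) ^ d * (2 * M0 : ℝ) ^ (-γ) / 2, by positivity, ?_⟩
  intro n φ hφ
  rcases Nat.eq_zero_or_pos n with hn | hn
  · have hne : -(γ / (γ + d)) ≠ 0 := by
      have : 0 < γ / (γ + d) := by positivity
      linarith
    subst hn
    rw [Nat.cast_zero, Real.zero_rpow hne, mul_zero, ENNReal.ofReal_zero]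
    exact zero_le
  have hn1 : (1 : ℝ) ≤ n := by exact_mod_cast hn
  have hn0 : (0 : ℝ) < n := by linarith
  set m : ℝ := (n : ℝ) ^ (1 / (γ + d)) with hm
  have hm1 : 1 ≤ m := Real.one_le_rpow hn1 (by positivity)
  set M : ℕ := M0 * ⌈m⌉₊ with hM
  have hceil : 0 < ⌈m⌉₊ := Nat.ceil_pos.2 (by linarith)
  have hMpos : 0 < M := Nat.mul_pos hM0 hceil
  have hMr : (0 : ℝ) < M := by exact_mod_cast hMpos
  have hMM0 : (M0 : ℝ) ≤ M := by
    exact_mod_cast Nat.le_mul_of_pos_right M0 hceil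
  have hmM : m ≤ M := by
    have h1 : (⌈m⌉₊ : ℝ) ≤ M := by exact_mod_cast Nat.le_mul_of_pos_left _ hM0
    exact (Nat.le_ceil m).trans h1
  have hMm : (M : ℝ) ≤ 2 * M0 * m := by
    have h1 : (⌈m⌉₊ : ℝ) < m + 1 := Nat.ceil_lt_add_one (by linarith)
    rw [hM]; push_cast
    nlinarith
  set a : ℝ := c1 * (M : ℝ)⁻¹ ^ (s - d / p.toReal) with ha
  have ha0 : 0 ≤ a := by positivity
  have ha2 : a ^ 2 = c1 ^ 2 * (M : ℝ) ^ (d - γ) := by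
    rw [ha, mul_pow, ← Real.rpow_natCast (_ ^ (_ : ℝ)), ← Real.rpow_mul (by positivity),
      Real.inv_rpow hMr.le, ← Real.rpow_neg hMr.le]
    congr 2
    rw [hγ, hν]; push_cast; ring
  have hnM : (n : ℝ) ≤ (M : ℝ) ^ (γ + d) := by
    have h1 : m ^ (γ + d) ≤ (M : ℝ) ^ (γ + d) := Real.rpow_le_rpow (by linarith) hmM (by positivity)
    rwa [hm, ← Real.rpow_mul hn0.le, one_div_mul_cancel (by positivity), Real.rpow_one] at h1
  have hMγ : (2 * M0 : ℝ) ^ (-γ) * (n : ℝ) ^ (-(γ / (γ + d))) ≤ (M : ℝ) ^ (-γ) := by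
    have h1 : (2 * M0 * m : ℝ) ^ (-γ) ≤ (M : ℝ) ^ (-γ) :=
      Real.rpow_le_rpow_of_nonpos hMr hMm (by linarith)
    rw [Real.mul_rpow (by positivity) (by positivity), hm, ← Real.rpow_mul hn0.le] at h1
    have e : 1 / (γ + d) * -γ = -(γ / (γ + d)) := by ring
    rwa [e] at h1
  have : Nonempty (Fin M) := ⟨⟨0, hMpos⟩⟩
  have hcard : (Fintype.card (Fin d → Fin M) : ℝ) = (M : ℝ) ^ d := by simp
  have hv : a ^ 2 * n ≤ ((σnoise ^ 2 : NNReal) : ℝ) * (Fintype.card (Fin d → Fin M) : ℝ) ^ 2 := by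
    rw [hcard, ha2]
    have hc : c1 ≤ σnoise := min_le_right _ _
    push_cast
    calc c1 ^ 2 * (M : ℝ) ^ (d - γ) * n ≤
          (σnoise : ℝ) ^ 2 * (M : ℝ) ^ (d - γ) * (M : ℝ) ^ (γ + d) := by gcongr
      _ = (σnoise : ℝ) ^ 2 * ((M : ℝ) ^ d) ^ 2 := by
        rw [mul_assoc, ← Real.rpow_add hMr, ← Real.rpow_natCast (M : ℝ) d,
          ← Real.rpow_natCast (_ ^ (_ : ℝ)), ← Real.rpow_mul hMr.le]
        congr 2
        push_cast; ring
  set X : ℝ := a ^ 2 * (volB d * ((M : ℝ)⁻¹ / 4) ^ d) with hX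
  have hX0 : 0 ≤ X := by positivity
  have hXe : X = c1 ^ 2 * volB d * (1 / 4) ^ d * (M : ℝ) ^ (-γ) := by
    have e1 : (M : ℝ) ^ (d - γ) = (M : ℝ) ^ d * (M : ℝ) ^ (-γ) := by
      rw [sub_eq_add_neg, Real.rpow_add hMr, Real.rpow_natCast]
    rw [hX, ha2, e1, div_eq_mul_one_div, mul_pow, inv_pow]
    have : (M : ℝ) ^ d ≠ 0 := by positivity
    field_simp
  have hTX : ENNReal.ofReal (Real.sqrt X) ^ 2 = ENNReal.ofReal X := by
    rw [← ENNReal.ofReal_pow (Real.sqrt_nonneg _), Real.sq_sqrt hX0]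
  refine le_of_forall_ge fun S hS => ?_
  rw [iSup₂_le_iff] at hS
  have key := exists_risk (ι := Fin d → Fin M) (cubeMeasure d) n
    (fun j => fBump a (M : ℝ) (gridC j)) (fun j => (fBump_cont _ _ _).measurable) φ hφ a ha0
    (fun y => grid_sum_le hMpos a ha0 y) (σnoise ^ 2) hv (ENNReal.ofReal (Real.sqrt X))
    (fun j => by
      rw [← ENNReal.pow_le_pow_left_iff two_ne_zero, hTX]
      exact grid_norm hMpos a ha0 j) S
    (fun j => hS (fBump a (M : ℝ) (gridC j))
      (Set.mem_iUnion₂.2 ⟨gridC j, gridC_mem j,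
        hmem M hMM0 (gridC j) (gridC_mem j) c1 hc1.le (min_le_left _ _)⟩))
  rw [hTX] at key
  have h2 : ENNReal.ofReal (2 * (c1 ^ 2 * volB d * (1 / 4) ^ d * (2 * M0 : ℝ) ^ (-γ) / 2 *
      (n : ℝ) ^ (-(γ / (γ + d))))) ≤ ENNReal.ofReal X := by
    apply ENNReal.ofReal_le_ofReal
    rw [hXe]
    calc _ = c1 ^ 2 * volB d * (1 / 4) ^ d *
          ((2 * M0 : ℝ) ^ (-γ) * (n : ℝ) ^ (-(γ / (γ + d)))) := by ring
      _ ≤ _ := by gcongr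
  have h3 := h2.trans key
  rw [ENNReal.ofReal_mul (by norm_num), ENNReal.ofReal_ofNat] at h3
  exact (ENNReal.mul_le_mul_iff_right (by norm_num) (by norm_num)).1 h3
end
end

section
/- Let d ≥ 1, 0 < p, q ≤ ∞, s, α, β > 0, and s(x) = s + β‖x‖₂^α on Ω = [0,1]^d. Fix a B-spline degree m ∈ ℕ with max_{x∈Ω} s(x) < m. Then there exist a constant C > 0 and k₀ ∈ ℕ such that for all integers k ≥ k₀, ‖M_{k,0}^d‖_{B_{p,q}^{s(x)}(Ω)} ≤ C 2^{k(s − d/p)}. -/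
open MeasureTheory
open scoped ENNReal NNReal Classical

noncomputable section

/-! ### One-dimensional estimates -/

/-- A family of bounds on iterated differences passes to products. -/
lemma aux_fwdDiff_mul {E : Type*} [AddCommMonoid E] (h : E) (c : ℝ) (hc : 0 ≤ c) (n : ℕ) :
    ∀ (F G : E → ℝ) (A B : ℝ), 0 ≤ A → 0 ≤ B →
      (∀ j ≤ n, ∀ x, |(fwdDiff h)^[j] F x| ≤ A * c ^ j) →
      (∀ j ≤ n, ∀ x, |(fwdDiff h)^[j] G x| ≤ B * c ^ j) →
      ∀ x, |(fwdDiff h)^[n] (fun y => F y * G y) x| ≤ 2 ^ n * A * B * c ^ n := by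
  induction n with
  | zero =>
    intro F G A B hA hB hF hG x
    have h1 := hF 0 le_rfl x
    have h2 := hG 0 le_rfl x
    simp only [Function.iterate_zero, id_eq, pow_zero, mul_one, one_mul] at h1 h2 ⊢
    rw [abs_mul]
    exact mul_le_mul h1 h2 (abs_nonneg _) hA
  | succ n ih =>
    intro F G A B hA hB hF hG x
    have key : fwdDiff h (fun y => F y * G y) =
        (fun y => F (y + h) * fwdDiff h G y) + (fun y => fwdDiff h F y * G y) := by
      funext y
      simp only [fwdDiff, Pi.add_apply]
      ring
    rw [Function.iterate_succ_apply, key, fwdDiff_iter_add, Pi.add_apply]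
    have e1 := ih (fun y => F (y + h)) (fwdDiff h G) A (B * c) hA (by positivity)
      (fun j hj y => by
        rw [fwdDiff_iter_comp_add]; exact hF j (by omega) _)
      (fun j hj y => by
        rw [← Function.iterate_succ_apply]
        refine (hG (j + 1) (by omega) y).trans (le_of_eq (by ring))) x
    have e2 := ih (fwdDiff h F) G (A * c) B (by positivity) hB
      (fun j hj y => by
        rw [← Function.iterate_succ_apply]
        refine (hF (j + 1) (by omega) y).trans (le_of_eq (by ring)))
      (fun j hj y => hG j (by omega) y) x
    refine (abs_add_le _ _).trans ((add_le_add e1 e2).trans (le_of_eq (by ring)))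

lemma aux_fwdDiff_bdd {E : Type*} [AddCommMonoid E] (h : E) (F : E → ℝ) (B : ℝ)
    (hF : ∀ x, |F x| ≤ B) (n : ℕ) : ∀ x, |(fwdDiff h)^[n] F x| ≤ 2 ^ n * B := by
  induction n with
  | zero => simpa using hF
  | succ n ih =>
    intro x
    rw [Function.iterate_succ_apply', fwdDiff]
    refine (abs_sub _ _).trans ((add_le_add (ih _) (ih _)).trans (le_of_eq (by ring)))

lemma aux_fwdDiff_prod {E ι : Type*} [AddCommMonoid E] (h : E) (c : ℝ) (hc : 0 ≤ c) (r : ℕ)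
    (F : ι → E → ℝ) (A : ℝ) (hA : 0 ≤ A)
    (hF : ∀ i, ∀ j ≤ r, ∀ x, |(fwdDiff h)^[j] (F i) x| ≤ A * c ^ j) (S : Finset ι) :
    ∀ j ≤ r, ∀ x, |(fwdDiff h)^[j] (fun y => ∏ i ∈ S, F i y) x| ≤
      (2 ^ r * A) ^ S.card * c ^ j := by
  classical
  induction S using Finset.induction_on with
  | empty =>
    intro j hj x
    simp only [Finset.prod_empty, Finset.card_empty, pow_zero, one_mul]
    rcases j with _ | j
    · simp
    · have : ((fwdDiff h)^[j+1] (fun _ : E => (1:ℝ))) = fun _ => 0 := by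
        induction j with
        | zero => simp
        | succ j ih => rw [Function.iterate_succ_apply', ih (by omega)]; simp
      rw [this]; simp; positivity
  | insert a S ha ih =>
    intro j hj x
    simp only [Finset.prod_insert ha, Finset.card_insert_of_notMem ha]
    have := aux_fwdDiff_mul h c hc j (F a) (fun y => ∏ i ∈ S, F i y) A ((2 ^ r * A) ^ S.card)
      hA (by positivity) (fun i hi => hF a i (by omega)) (fun i hi => ih i (by omega)) x
    refine this.trans ?_
    rw [pow_succ]
    have h2 : (2:ℝ) ^ j ≤ 2 ^ r := pow_le_pow_right₀ (by norm_num) hj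
    have : 0 ≤ A * (2 ^ r * A) ^ S.card * c ^ j := by positivity
    nlinarith [mul_le_mul_of_nonneg_right h2 this]

/-- Truncated power sums. -/
def auxT (m n : ℕ) (x : ℝ) : ℝ :=
  ∑ j ∈ Finset.range (m + 2), (-1 : ℝ) ^ j * ((m + 1).choose j : ℝ) * max (x - j) 0 ^ n

lemma auxT_zero_left (m n : ℕ) (hn : 1 ≤ n) (x : ℝ) (hx : x ≤ 0) : auxT m n x = 0 := by
  unfold auxT
  refine Finset.sum_eq_zero fun j _ => ?_
  have : max (x - j) 0 = 0 := max_eq_right (by have : (0:ℝ) ≤ j := by positivity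
                                               linarith)
  rw [this, zero_pow (by omega), mul_zero]

lemma auxT_zero_right (m n : ℕ) (hn : n ≤ m) (x : ℝ) (hx : (m:ℝ) + 1 ≤ x) : auxT m n x = 0 := by
  have h0 := congrFun (fwdDiff_iter_pow_eq_zero_of_lt (R := ℝ) (show n < m + 1 by omega)) (-x)
  rw [fwdDiff_iter_eq_sum_shift] at h0
  unfold auxT
  have : ∑ j ∈ Finset.range (m + 2), (-1 : ℝ) ^ j * ((m + 1).choose j : ℝ) * max (x - j) 0 ^ n
     = (-1) ^ n * (-1) ^ (m + 1) * ∑ k ∈ Finset.range (m + 1 + 1),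
        ((-1 : ℤ) ^ (m + 1 - k) * ((m + 1).choose k)) • (-x + k • (1:ℝ)) ^ n := by
    rw [Finset.mul_sum]
    refine Finset.sum_congr rfl fun j hj => ?_
    have hj' : j ≤ m + 1 := by simpa [Nat.lt_succ_iff] using hj
    have hj'' : (j:ℝ) ≤ m + 1 := by exact_mod_cast hj'
    rw [max_eq_left (by linarith)]
    obtain ⟨i, hi⟩ := Nat.exists_eq_add_of_le hj'
    rw [hi, Nat.add_sub_cancel_left]
    have e : (x - j) ^ n = (-1) ^ n * (-x + j • (1:ℝ)) ^ n := by
      rw [← mul_pow]; congr 1; simp; ring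
    rw [e]
    simp only [zsmul_eq_mul]
    push_cast
    have e2 : (-1:ℝ) ^ (j + i) * (-1) ^ i = (-1) ^ j := by
      rw [pow_add, mul_assoc, ← mul_pow]; simp
    rw [← e2]; ring
  rw [this, h0]; simp

lemma auxT_continuous (m n : ℕ) : Continuous (auxT m n) := by
  unfold auxT; fun_prop

lemma auxT_bdd (m n : ℕ) (hn : 1 ≤ n) (hnm : n ≤ m) : ∃ B : ℝ, 0 ≤ B ∧ ∀ x, |auxT m n x| ≤ B := by
  obtain ⟨B, hB⟩ := isCompact_Icc.exists_bound_of_continuousOn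
    (s := Set.Icc (0:ℝ) (m + 1)) (auxT_continuous m n).continuousOn
  refine ⟨max B 0, le_max_right _ _, fun x => ?_⟩
  by_cases h1 : x ≤ 0
  · rw [auxT_zero_left m n hn x h1]; simp
  by_cases h2 : (m:ℝ) + 1 ≤ x
  · rw [auxT_zero_right m n hnm x h2]; simp
  · exact (hB x ⟨by linarith, by linarith⟩).trans (le_max_left _ _)

lemma aux_trunc_hasDerivAt (n : ℕ) (x : ℝ) :
    HasDerivAt (fun x : ℝ => max x 0 ^ (n + 2)) ((n + 2 : ℕ) * max x 0 ^ (n + 1)) x := by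
  rcases lt_trichotomy x 0 with h | h | h
  · have : (fun x : ℝ => max x 0 ^ (n + 2)) =ᶠ[nhds x] fun _ => 0 := by
      filter_upwards [gt_mem_nhds h] with y hy
      rw [max_eq_right hy.le]; simp
    rw [max_eq_right h.le]
    simpa using (hasDerivAt_const x (0:ℝ)).congr_of_eventuallyEq this
  · subst h
    rw [hasDerivAt_iff_isLittleO]
    simp only [max_self, ne_eq, Nat.add_eq_zero_iff, OfNat.ofNat_ne_zero, and_false,
      not_false_eq_true, zero_pow, sub_zero, one_ne_zero, mul_zero, smul_zero]
    have h1 : (fun x : ℝ => max x 0 ^ (n + 2)) =O[nhds 0] fun x : ℝ => x ^ (n + 2) := by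
      refine Asymptotics.isBigO_of_le _ fun x => ?_
      rw [norm_pow, norm_pow]
      gcongr
      rcases le_total x 0 with h | h
      · rw [max_eq_right h]; simp
      · rw [max_eq_left h]
    exact h1.trans_isLittleO (Asymptotics.isLittleO_pow_id (by omega))
  · have : (fun x : ℝ => max x 0 ^ (n + 2)) =ᶠ[nhds x] fun x => x ^ (n + 2) := by
      filter_upwards [lt_mem_nhds h] with y hy
      rw [max_eq_left hy.le]
    rw [max_eq_left h.le]
    simpa using (hasDerivAt_pow (n + 2) x).congr_of_eventuallyEq this

lemma auxT_hasDerivAt (m n : ℕ) (x : ℝ) :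
    HasDerivAt (auxT m (n + 2)) ((n + 2 : ℕ) * auxT m (n + 1) x) x := by
  unfold auxT
  rw [Finset.mul_sum]
  refine HasDerivAt.fun_sum fun j _ => ?_
  have := ((aux_trunc_hasDerivAt n (x - j)).comp_sub_const x (j:ℝ)).const_mul
    ((-1 : ℝ) ^ j * ((m + 1).choose j : ℝ))
  refine this.congr_deriv ?_
  ring

lemma aux_fwdDiff_hasDerivAt (F F' : ℝ → ℝ) (hF : ∀ x, HasDerivAt F (F' x) x) (h : ℝ) (j : ℕ) :
    ∀ x, HasDerivAt ((fwdDiff h)^[j] F) ((fwdDiff h)^[j] F' x) x := by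
  induction j with
  | zero => simpa using hF
  | succ j ih =>
    intro x
    rw [Function.iterate_succ_apply', Function.iterate_succ_apply']
    exact ((ih (x + h)).comp_add_const x h).sub (ih x)

lemma auxT_lip (m : ℕ) : ∃ A : ℝ, 0 ≤ A ∧ ∀ x y, |auxT m 1 x - auxT m 1 y| ≤ A * |x - y| := by
  refine ⟨∑ j ∈ Finset.range (m + 2), |(-1 : ℝ) ^ j * ((m + 1).choose j : ℝ)|,
    by positivity, fun x y => ?_⟩
  unfold auxT
  rw [← Finset.sum_sub_distrib, Finset.sum_mul]
  refine (Finset.abs_sum_le_sum_abs _ _).trans (Finset.sum_le_sum fun j _ => ?_)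
  rw [← mul_sub, abs_mul]
  refine mul_le_mul_of_nonneg_left ?_ (abs_nonneg _)
  rw [pow_one, pow_one]
  have h := abs_max_sub_max_le_abs (x - (j:ℝ)) (y - (j:ℝ)) 0
  rwa [sub_sub_sub_cancel_right] at h

lemma auxT_diff (m : ℕ) (j : ℕ) : ∀ n, 1 ≤ n → n ≤ m → j ≤ n →
    ∃ A : ℝ, 0 ≤ A ∧ ∀ h x, |(fwdDiff h)^[j] (auxT m n) x| ≤ A * |h| ^ j := by
  induction j with
  | zero =>
    intro n hn hnm _
    obtain ⟨B, hB, h⟩ := auxT_bdd m n hn hnm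
    exact ⟨B, hB, fun _ x => by simpa using h x⟩
  | succ j ih =>
    intro n hn hnm hj
    rcases n with _ | _ | n
    · omega
    · obtain rfl : j = 0 := by omega
      obtain ⟨A, hA, h⟩ := auxT_lip m
      refine ⟨A, hA, fun u x => ?_⟩
      have := h (x + u) x
      simpa [fwdDiff] using this
    · obtain ⟨A, hA, hb⟩ := ih (n + 1) (by omega) (by omega) (by omega)
      refine ⟨(n + 2 : ℕ) * A, by positivity, fun u x => ?_⟩
      rw [Function.iterate_succ_apply', fwdDiff]
      have hd := aux_fwdDiff_hasDerivAt _ _ (auxT_hasDerivAt m n) u j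
      have := Convex.norm_image_sub_le_of_norm_hasDerivWithin_le (s := Set.univ)
        (f := (fwdDiff u)^[j] (auxT m (n + 2))) (x := x) (y := x + u)
        (C := (n + 2 : ℕ) * A * |u| ^ j)
        (fun y _ => (hd y).hasDerivWithinAt) (fun y _ => by
          have e : (fun x => ((n + 2 : ℕ) : ℝ) * auxT m (n + 1) x) =
            ((n + 2 : ℕ) : ℝ) • auxT m (n + 1) := rfl
          rw [e, fwdDiff_iter_const_smul, Pi.smul_apply, smul_eq_mul, norm_mul]
          rw [Real.norm_eq_abs, Real.norm_eq_abs, Nat.abs_cast, mul_assoc]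
          exact mul_le_mul_of_nonneg_left (hb u y) (by positivity)) convex_univ trivial trivial
      refine this.trans (le_of_eq ?_)
      rw [add_sub_cancel_left, Real.norm_eq_abs]; ring

lemma bspline_eq (m : ℕ) : bspline m = (m.factorial : ℝ)⁻¹ • auxT m m := rfl

lemma bspline_support (m : ℕ) (hm : 1 ≤ m) (x : ℝ) (hx : bspline m x ≠ 0) :
    0 ≤ x ∧ x ≤ m + 1 := by
  rw [bspline_eq, Pi.smul_apply, smul_eq_mul] at hx
  have h := right_ne_zero_of_mul hx
  constructor
  · by_contra h1
    exact h (auxT_zero_left m m hm x (by linarith))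
  · by_contra h1
    exact h (auxT_zero_right m m le_rfl x (by linarith))

/-- Uniform bound on the differences of the B-spline up to order `m`. -/
lemma bspline_diff (m : ℕ) (hm : 1 ≤ m) : ∃ A : ℝ, 0 ≤ A ∧ ∀ j ≤ m, ∀ h x,
    |(fwdDiff h)^[j] (bspline m) x| ≤ A * |h| ^ j := by
  have : ∀ j, ∃ A : ℝ, 0 ≤ A ∧ (j ≤ m → ∀ h x,
      |(fwdDiff h)^[j] (bspline m) x| ≤ A * |h| ^ j) := by
    intro j
    by_cases hj : j ≤ m
    · obtain ⟨A, hA, h⟩ := auxT_diff m j m hm le_rfl hj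
      refine ⟨(m.factorial : ℝ)⁻¹ * A, by positivity, fun _ u x => ?_⟩
      rw [bspline_eq, fwdDiff_iter_const_smul, Pi.smul_apply, smul_eq_mul, abs_mul, mul_assoc,
        abs_of_nonneg (by positivity : 0 ≤ (m.factorial : ℝ)⁻¹)]
      exact mul_le_mul_of_nonneg_left (h u x) (by positivity)
    · exact ⟨0, le_rfl, fun h => absurd h hj⟩
  choose A hA hb using this
  refine ⟨∑ j ∈ Finset.range (m + 1), A j, Finset.sum_nonneg fun j _ => hA j, fun j hj u x => ?_⟩
  refine (hb j hj u x).trans ?_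
  gcongr
  exact Finset.single_le_sum (fun j _ => hA j) (Finset.mem_range.2 (by omega))

/-! ### Estimates for the tensor-product spline -/

lemma aux_fwdDiff_comp {E : Type*} [AddCommMonoid E] (φ : E → ℝ)
    (hφ : ∀ x y, φ (x + y) = φ x + φ y) (N : ℝ → ℝ) (h : E) (j : ℕ) :
    ∀ x, (fwdDiff h)^[j] (fun y => N (φ y)) x = (fwdDiff (φ h))^[j] N (φ x) := by
  induction j with
  | zero => intro x; rfl
  | succ j ih =>
    intro x
    rw [Function.iterate_succ_apply', Function.iterate_succ_apply', fwdDiff, fwdDiff, ih, ih, hφ]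

lemma aux_coord_le {d : ℕ} (h : Euc d) (i : Fin d) : |h i| ≤ ‖h‖ := by
  simpa using PiLp.norm_apply_le h i

lemma Mspline_eq (d m k : ℕ) :
    Mspline d m k 0 = fun x => ∏ i, bspline m ((2:ℝ) ^ k * x i) := by
  funext x; simp [Mspline]

lemma Mspline_diff (d m r : ℕ) (hm : 1 ≤ m) (hr : r ≤ m) : ∃ K : ℝ, 0 < K ∧ ∀ k : ℕ,
    (∀ x, |Mspline d m k 0 x| ≤ K) ∧
    ∀ (h x : Euc d), |(fwdDiff h)^[r] (Mspline d m k 0) x| ≤ K ∧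
      |(fwdDiff h)^[r] (Mspline d m k 0) x| ≤ K * ((2:ℝ) ^ k * ‖h‖) ^ r := by
  obtain ⟨A, hA, hb⟩ := bspline_diff m hm
  have hB : ∀ k : ℕ, ∀ x : Euc d, |Mspline d m k 0 x| ≤ A ^ d := by
    intro k x
    rw [Mspline_eq, Finset.abs_prod]
    refine (Finset.prod_le_prod (fun i _ => abs_nonneg _) (g := fun _ => A) fun i _ => ?_).trans ?_
    · simpa using hb 0 (by omega) 0 (2 ^ k * x i)
    · simp
  have h1 : (0:ℝ) < 2 ^ r * A ^ d + A ^ d + (2 ^ r * A) ^ d + 1 := by positivity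
  refine ⟨2 ^ r * A ^ d + A ^ d + (2 ^ r * A) ^ d + 1, h1, fun k => ⟨fun x => ?_, fun h x => ⟨?_, ?_⟩⟩⟩
  · refine (hB k x).trans ?_
    have : 0 ≤ 2 ^ r * A ^ d := by positivity
    have : 0 ≤ (2 ^ r * A) ^ d := by positivity
    linarith
  · refine (aux_fwdDiff_bdd h _ _ (hB k) r x).trans ?_
    have : 0 ≤ A ^ d := by positivity
    have : 0 ≤ (2 ^ r * A) ^ d := by positivity
    linarith
  · have := aux_fwdDiff_prod h ((2:ℝ) ^ k * ‖h‖) (by positivity) r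
      (fun (i : Fin d) (x : Euc d) => bspline m ((2:ℝ) ^ k * x i)) A hA (by
        intro i j hj y
        rw [aux_fwdDiff_comp (fun x : Euc d => (2:ℝ) ^ k * x i) (by intro x y; simp; ring)]
        refine (hb j (by omega) _ _).trans ?_
        gcongr
        rw [abs_mul, abs_of_nonneg (by positivity : (0:ℝ) ≤ 2 ^ k)]
        gcongr
        exact aux_coord_le h i) Finset.univ r le_rfl x
    rw [Mspline_eq]
    refine this.trans ?_
    gcongr
    rw [Finset.card_univ, Fintype.card_fin]
    have : 0 ≤ A ^ d := by positivity
    have : 0 ≤ 2 ^ r * A ^ d := by positivity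
    linarith

lemma rDiff_eq {d : ℕ} (r : ℕ) (h : Euc d) (f : Euc d → ℝ) (x : Euc d) :
    rDiff r h f x = if x ∈ unitCube d ∧ x + (r : ℝ) • h ∈ unitCube d then
      (fwdDiff h)^[r] f x else 0 := by
  unfold rDiff
  split_ifs
  · rw [fwdDiff_iter_eq_sum_shift]
    refine Finset.sum_congr rfl fun j _ => ?_
    rw [zsmul_eq_mul, Nat.cast_smul_eq_nsmul]
    push_cast; rfl
  · rfl

/-- The small cube `[0, a]^d`. -/
def auxQ (d : ℕ) (a : ℝ) : Set (Euc d) := {x | ∀ i, x i ∈ Set.Icc (0 : ℝ) a}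

lemma auxQ_volume (d : ℕ) (a : ℝ) (ha : 0 ≤ a) : volume (auxQ d a) = ENNReal.ofReal (a ^ d) := by
  have h := EuclideanSpace.volume_preserving_symm_measurableEquiv_toLp (Fin d)
  have e : auxQ d a = (MeasurableEquiv.toLp 2 (Fin d → ℝ)).symm ⁻¹'
      (Set.pi Set.univ fun _ => Set.Icc (0:ℝ) a) := by
    ext x; simp only [auxQ, Set.mem_setOf_eq, Set.mem_preimage, Set.mem_pi, Set.mem_univ, true_imp_iff]; rfl
  rw [e, h.measure_preimage_equiv, volume_pi_pi]
  simp [ENNReal.ofReal_pow ha]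

/-- The union of translates of the small cube. -/
def auxE {d : ℕ} (r : ℕ) (h : Euc d) (a : ℝ) : Set (Euc d) :=
  ⋃ j ∈ Finset.range (r + 1), (fun x => x + (j:ℝ) • h) ⁻¹' auxQ d a

lemma auxE_volume {d : ℕ} (r : ℕ) (h : Euc d) (a : ℝ) (ha : 0 ≤ a) :
    volume (auxE r h a) ≤ ENNReal.ofReal ((r + 1) * a ^ d) := by
  unfold auxE
  refine (measure_biUnion_finset_le _ _).trans ?_
  simp only [measure_preimage_add_right, auxQ_volume d a ha]
  rw [Finset.sum_const, Finset.card_range, ENNReal.ofReal_mul (by positivity), nsmul_eq_mul]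
  gcongr
  rw [← Nat.cast_succ, ENNReal.ofReal_natCast]

lemma auxQ_norm {d : ℕ} (a : ℝ) (ha : 0 ≤ a) (x : Euc d) (hx : x ∈ auxQ d a) : ‖x‖ ≤ d * a := by
  rw [EuclideanSpace.norm_eq, Real.sqrt_le_left (by positivity)]
  have : ∑ i, ‖x i‖ ^ 2 ≤ ∑ i : Fin d, a ^ 2 := by
    refine Finset.sum_le_sum fun i _ => ?_
    have := hx i
    rw [Real.norm_eq_abs, abs_of_nonneg this.1]
    exact pow_le_pow_left₀ this.1 this.2 2
  refine this.trans ?_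
  rw [Finset.sum_const, Finset.card_univ, Fintype.card_fin, nsmul_eq_mul, mul_pow]
  gcongr
  rcases Nat.eq_zero_or_pos d with h | h
  · simp [h]
  · have : (1:ℝ) ≤ d := by exact_mod_cast h
    nlinarith

lemma Mspline_support (d m k : ℕ) (hm : 1 ≤ m) (x : Euc d) (hx : Mspline d m k 0 x ≠ 0) :
    x ∈ auxQ d ((m + 1) * ((2:ℝ) ^ k)⁻¹) := by
  rw [Mspline_eq] at hx
  intro i
  have h := bspline_support m hm _ (Finset.prod_ne_zero_iff.1 hx i (Finset.mem_univ i))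
  have h2 : (0:ℝ) < 2 ^ k := by positivity
  constructor
  · exact nonneg_of_mul_nonneg_right h.1 h2
  · rw [← div_eq_mul_inv, le_div_iff₀ h2, mul_comm]; exact h.2

lemma rDiff_support (d m k r : ℕ) (hm : 1 ≤ m) (h x : Euc d)
    (hx : rDiff r h (Mspline d m k 0) x ≠ 0) :
    x ∈ auxE r h ((m + 1) * ((2:ℝ) ^ k)⁻¹) := by
  unfold rDiff at hx
  split_ifs at hx
  · obtain ⟨j, hj, hne⟩ := Finset.exists_ne_zero_of_sum_ne_zero hx
    unfold auxE
    simp only [Set.mem_iUnion]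
    exact ⟨j, hj, Mspline_support d m k hm _ (right_ne_zero_of_mul hne)⟩
  · exact absurd rfl hx

lemma auxE_norm {d : ℕ} (r : ℕ) (h : Euc d) (a t : ℝ) (ha : 0 ≤ a) (ht : ‖h‖ ≤ t) (x : Euc d)
    (hx : x ∈ auxE r h a) : ‖x‖ ≤ d * a + r * t := by
  unfold auxE at hx
  simp only [Set.mem_iUnion] at hx
  obtain ⟨j, hj, hx⟩ := hx
  have h1 := auxQ_norm a ha _ hx
  have hj' : (j:ℝ) ≤ r := by
    have := Finset.mem_range.1 hj
    exact_mod_cast (by omega : j ≤ r)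
  calc ‖x‖ = ‖(x + (j:ℝ) • h) - (j:ℝ) • h‖ := by simp
    _ ≤ ‖x + (j:ℝ) • h‖ + ‖(j:ℝ) • h‖ := norm_sub_le _ _
    _ ≤ d * a + r * t := by
      rw [norm_smul]
      simp only [Real.norm_natCast]
      gcongr

/-! ### Weight estimates -/

lemma aux_weight (α κ u : ℝ) (hα : 0 < α) (hκ : 0 ≤ κ) (hu : 0 < u) (hu1 : u ≤ 1) :
    u ^ (-(κ * u ^ α)) ≤ Real.exp (κ / α) := by
  have hy : 0 < u ^ α := Real.rpow_pos_of_pos hu α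
  have h1 := Real.one_sub_inv_le_log_of_pos hy
  rw [Real.log_rpow hu] at h1
  have h2 : -(u ^ α * (α * Real.log u)) ≤ 1 := by
    have := mul_le_mul_of_nonneg_left h1 hy.le
    rw [mul_sub, mul_inv_cancel₀ hy.ne'] at this
    linarith
  rw [Real.rpow_def_of_pos hu]
  refine Real.exp_le_exp.2 ?_
  rw [le_div_iff₀ hα]
  nlinarith [mul_le_mul_of_nonneg_left h2 hκ]

/-- The profile function. -/
def auxg (a δ s t : ℝ) : ℝ := if t ≤ a then (t / a) ^ δ else (t / a) ^ (-s)

lemma auxg_nonneg (a δ s t : ℝ) (ha : 0 < a) (ht : 0 < t) : 0 ≤ auxg a δ s t := by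
  unfold auxg; split_ifs <;> positivity

lemma auxg_le_one (a δ s t : ℝ) (ha : 0 < a) (ht : 0 < t) (hδ : 0 ≤ δ) (hs : 0 ≤ s) :
    auxg a δ s t ≤ 1 := by
  unfold auxg
  split_ifs with h
  · exact Real.rpow_le_one (by positivity) ((div_le_one ha).2 h) hδ
  · exact Real.rpow_le_one_of_one_le_of_nonpos ((one_le_div ha).2 (by linarith)) (by linarith)

lemma aux_point (s α β K S : ℝ) (r : ℕ) (hs : 0 < s) (hα : 0 < α) (hβ : 0 < β) (hK : 0 ≤ K)
    (a t n D : ℝ) (ha : 0 < a) (ha1 : a ≤ 1) (ht : 0 < t) (hn : 0 ≤ n)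
    (hnS : s + β * n ^ α ≤ S) (hnK : n ≤ K * max a t) (hD0 : 0 ≤ D)
    (hD1 : D ≤ 1) (hDr : D ≤ (t / a) ^ r) :
    t ^ (-(s + β * n ^ α)) * D ≤
      Real.exp (β * K ^ α / α) * a ^ (-s) * auxg a (r - S) s t := by
  have hKa : 0 ≤ β * K ^ α := by positivity
  have hE : 1 ≤ Real.exp (β * K ^ α / α) := Real.one_le_exp (by positivity)
  unfold auxg
  split_ifs with h
  · have hτ : 0 < t / a := by positivity
    have hτ1 : t / a ≤ 1 := (div_le_one ha).2 h
    rw [max_eq_left h] at hnK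
    have e1 : t ^ (-(s + β * n ^ α)) =
        a ^ (-s) * a ^ (-(β * n ^ α)) * (t / a) ^ (-(s + β * n ^ α)) := by
      rw [← Real.rpow_add ha, ← neg_add, ← Real.mul_rpow ha.le hτ.le, mul_div_cancel₀ _ ha.ne']
    have e2 : a ^ (-(β * n ^ α)) ≤ Real.exp (β * K ^ α / α) := by
      refine le_trans ?_ (aux_weight α (β * K ^ α) a hα hKa ha ha1)
      refine Real.rpow_le_rpow_of_exponent_ge ha ha1 ?_
      rw [mul_assoc, ← Real.mul_rpow hK ha.le]
      gcongr
    have e3 : (t / a) ^ (-(s + β * n ^ α)) ≤ (t / a) ^ (-S) :=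
      Real.rpow_le_rpow_of_exponent_ge hτ hτ1 (by linarith)
    have e4 : (t / a) ^ ((r:ℝ) - S) = (t / a) ^ (-S) * (t / a) ^ r := by
      rw [← Real.rpow_natCast, ← Real.rpow_add hτ]; congr 1; ring
    rw [e1, e4]
    calc _ ≤ a ^ (-s) * Real.exp (β * K ^ α / α) * (t / a) ^ (-S) * (t / a) ^ r := by gcongr
      _ = _ := by ring
  · have h' : a ≤ t := by linarith
    rw [max_eq_right h'] at hnK
    have e0 : a ^ (-s) * (t / a) ^ (-s) = t ^ (-s) := by
      rw [← Real.mul_rpow ha.le (by positivity), mul_div_cancel₀ _ ha.ne']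
    have e1 : t ^ (-(s + β * n ^ α)) ≤ Real.exp (β * K ^ α / α) * t ^ (-s) := by
      rw [neg_add, Real.rpow_add ht, mul_comm]
      gcongr
      rcases le_total t 1 with h1 | h1
      · refine le_trans ?_ (aux_weight α (β * K ^ α) t hα hKa ht h1)
        refine Real.rpow_le_rpow_of_exponent_ge ht h1 ?_
        rw [mul_assoc, ← Real.mul_rpow hK ht.le]
        gcongr
      · refine le_trans ?_ hE
        refine Real.rpow_le_one_of_one_le_of_nonpos h1 ?_
        have : 0 ≤ β * n ^ α := by positivity
        linarith
    rw [mul_assoc, e0]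
    calc _ ≤ t ^ (-(s + β * n ^ α)) * 1 := by gcongr
      _ ≤ _ := by rw [mul_one]; exact e1

lemma auxg_lintegral (a δ s q : ℝ) (ha : 0 < a) (hδ : 0 < δ) (hs : 0 < s) (hq : 0 < q) :
    ∫⁻ t in Set.Ioo (0:ℝ) 1, ENNReal.ofReal (auxg a δ s t ^ q * (1 / t)) ≤
      ENNReal.ofReal (1 / (δ * q) + 1 / (s * q)) := by
  have hδq : 0 < δ * q := by positivity
  have hsq : 0 < s * q := by positivity
  have hsub : Set.Ioo (0:ℝ) 1 ⊆ Set.Ioc 0 a ∪ Set.Ioi a := by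
    intro t ht
    rcases le_or_gt t a with h | h
    · exact Or.inl ⟨ht.1, h⟩
    · exact Or.inr h
  refine (lintegral_mono_set hsub).trans ((lintegral_union_le _ _ _).trans ?_)
  rw [ENNReal.ofReal_add (by positivity) (by positivity)]
  refine add_le_add (le_of_eq ?_) (le_of_eq ?_)
  · have hint : IntegrableOn (fun t : ℝ => a ^ (-(δ * q)) * t ^ (δ * q - 1)) (Set.Ioc 0 a) := by
      refine Integrable.const_mul ?_ _
      exact (intervalIntegrable_iff_integrableOn_Ioc_of_le ha.le).1
        (intervalIntegral.intervalIntegrable_rpow' (by linarith))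
    have hval : ∫ t in Set.Ioc 0 a, a ^ (-(δ * q)) * t ^ (δ * q - 1) = 1 / (δ * q) := by
      rw [integral_const_mul, ← intervalIntegral.integral_of_le ha.le,
        integral_rpow (Or.inl (by linarith)), sub_add_cancel, Real.zero_rpow hδq.ne', sub_zero,
        ← mul_div_assoc, ← Real.rpow_add ha]
      simp
    rw [← hval, ofReal_integral_eq_lintegral_ofReal hint]
    · refine setLIntegral_congr_fun measurableSet_Ioc fun t ht => ?_
      have ht0 : 0 < t := ht.1
      simp only [auxg, if_pos ht.2]
      congr 1
      rw [← Real.rpow_mul (by positivity), Real.div_rpow ht0.le ha.le, Real.rpow_sub ht0,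
        Real.rpow_neg ha.le, Real.rpow_one]
      field_simp
    · refine (ae_restrict_iff' measurableSet_Ioc).2 (Filter.Eventually.of_forall fun t ht => ?_)
      have ht0 : 0 < t := ht.1
      simp only [Pi.zero_apply]
      positivity
  · have hint : IntegrableOn (fun t : ℝ => a ^ (s * q) * t ^ (-(s * q) - 1)) (Set.Ioi a) := by
      refine Integrable.const_mul ?_ _
      exact integrableOn_Ioi_rpow_of_lt (by linarith) ha
    have hval : ∫ t in Set.Ioi a, a ^ (s * q) * t ^ (-(s * q) - 1) = 1 / (s * q) := by
      rw [integral_const_mul, integral_Ioi_rpow_of_lt (by linarith) ha, sub_add_cancel,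
        neg_div_neg_eq, ← mul_div_assoc, ← Real.rpow_add ha]
      simp
    rw [← hval, ofReal_integral_eq_lintegral_ofReal hint]
    · refine setLIntegral_congr_fun measurableSet_Ioi fun t ht => ?_
      have ht1 : a < t := ht
      have ht0 : 0 < t := ha.trans ht1
      simp only [auxg, if_neg (not_le.2 ht1)]
      congr 1
      rw [← Real.rpow_mul (by positivity), Real.div_rpow ht0.le ha.le, Real.rpow_sub ht0,
        neg_mul, Real.rpow_neg ha.le, Real.rpow_one]
      field_simp
    · refine (ae_restrict_iff' measurableSet_Ioi).2 (Filter.Eventually.of_forall fun t ht => ?_)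
      have ht0 : 0 < t := ha.trans ht
      simp only [Pi.zero_apply]
      positivity

lemma aux_eLpNorm {d : ℕ} (p : ℝ≥0∞) (g : Euc d → ℝ) (E : Set (Euc d)) (W V : ℝ)
    (hW : 0 ≤ W) (hV : 0 ≤ V) (hE : volume E ≤ ENNReal.ofReal V)
    (hg : ∀ x ∈ unitCube d, |g x| ≤ W) (hg0 : ∀ x, x ∉ E → g x = 0) :
    eLpNorm g p (cubeMeasure d) ≤ ENNReal.ofReal (W * V ^ (1 / p.toReal)) := by
  have hms : MeasurableSet (unitCube d) := by
    have : unitCube d = ⋂ i, (fun x : Euc d => x i) ⁻¹' Set.Icc (0:ℝ) 1 := by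
      ext x; simp [unitCube]
    rw [this]
    exact MeasurableSet.iInter fun i => (by fun_prop : Measurable fun x : Euc d => x i)
      measurableSet_Icc
  have h1 : eLpNorm g p (cubeMeasure d) ≤ eLpNorm (E.indicator fun _ => W) p (cubeMeasure d) := by
    refine eLpNorm_mono_ae ?_
    refine (ae_restrict_iff' hms).2 (Filter.Eventually.of_forall fun x hx => ?_)
    by_cases hxE : x ∈ E
    · rw [Set.indicator_of_mem hxE, Real.norm_eq_abs, Real.norm_eq_abs, abs_of_nonneg hW]
      exact hg x hx
    · rw [hg0 x hxE]; simp
  refine h1.trans ((eLpNorm_indicator_const_le _ _).trans ?_)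
  rw [ENNReal.ofReal_mul hW, ← ENNReal.ofReal_rpow_of_nonneg hV (by positivity),
    Real.enorm_of_nonneg hW]
  gcongr
  exact (Measure.restrict_apply_le _ _).trans hE

lemma aux_semi {d : ℕ} (p q : ℝ≥0∞) (hq : 0 < q) (σ : Euc d → ℝ) (r : ℕ) (f : Euc d → ℝ)
    (a δ s B : ℝ) (ha : 0 < a) (hδ : 0 < δ) (hs : 0 < s) (hB : 0 ≤ B)
    (h : ∀ t, 0 < t → omegaStar p σ r f t ≤ ENNReal.ofReal (B * auxg a δ s t)) :
    vBesovSemi p q σ r f ≤ ENNReal.ofReal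
      (B * ((1 / (δ * q.toReal) + 1 / (s * q.toReal)) ^ (1 / q.toReal) + 1)) := by
  have hJ : 0 ≤ (1 / (δ * q.toReal) + 1 / (s * q.toReal)) := by positivity
  unfold vBesovSemi
  split_ifs with hqt
  · refine iSup₂_le fun t ht => (h t ht).trans (ENNReal.ofReal_le_ofReal ?_)
    have h1 := auxg_le_one a δ s t ha ht hδ.le hs.le
    have h2 : 0 ≤ (1 / (δ * q.toReal) + 1 / (s * q.toReal)) ^ (1 / q.toReal) := by positivity
    exact mul_le_mul_of_nonneg_left (by linarith) hB
  · have hq' : 0 < q.toReal := ENNReal.toReal_pos hq.ne' hqt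
    have h1 : ∫⁻ t in Set.Ioo (0 : ℝ) 1,
        (omegaStar p σ r f t) ^ q.toReal * ENNReal.ofReal (1 / t) ≤
        ENNReal.ofReal (B ^ q.toReal * (1 / (δ * q.toReal) + 1 / (s * q.toReal))) := by
      calc _ ≤ ∫⁻ t in Set.Ioo (0 : ℝ) 1, ENNReal.ofReal (B ^ q.toReal) *
            ENNReal.ofReal (auxg a δ s t ^ q.toReal * (1 / t)) := by
            refine setLIntegral_mono' measurableSet_Ioo fun t ht => ?_
            have hg := auxg_nonneg a δ s t ha ht.1
            have ht0 : 0 < t := ht.1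
            rw [← ENNReal.ofReal_mul (by positivity), ← mul_assoc,
              ← Real.mul_rpow hB hg, ENNReal.ofReal_mul (by positivity),
              ← ENNReal.ofReal_rpow_of_nonneg (by positivity) hq'.le]
            gcongr
            exact h t ht0
        _ = ENNReal.ofReal (B ^ q.toReal) * ∫⁻ t in Set.Ioo (0 : ℝ) 1,
            ENNReal.ofReal (auxg a δ s t ^ q.toReal * (1 / t)) :=
            lintegral_const_mul' _ _ ENNReal.ofReal_ne_top
        _ ≤ _ := by
            rw [ENNReal.ofReal_mul (by positivity)]
            gcongr
            exact auxg_lintegral a δ s _ ha hδ hs hq'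
    refine (ENNReal.rpow_le_rpow h1 (by positivity)).trans ?_
    rw [ENNReal.ofReal_rpow_of_nonneg (by positivity) (by positivity)]
    refine ENNReal.ofReal_le_ofReal ?_
    rw [Real.mul_rpow (by positivity) hJ, ← Real.rpow_mul hB, mul_one_div_cancel hq'.ne',
      Real.rpow_one]
    exact mul_le_mul_of_nonneg_left (by linarith) hB

lemma unitCube_eq (d : ℕ) : unitCube d = auxQ d 1 := rfl

/-- Lemma A.3. For `s, α, β > 0`, `σ(x) = s + β‖x‖₂^α` on `Ω = [0,1]^d`,
and a B-spline degree `m` with `sup_Ω σ < m`, there exist `C > 0` and `k₀` such that for all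
`k ≥ k₀`, `‖M_{k,0}^d‖_{B^{σ}_{p,q}(Ω)} ≤ C 2^{k(s − d/p)}`. -/
theorem Mspline_vBesov_norm_bound (d m : ℕ) (hd : 1 ≤ d) (hm : 1 ≤ m)
    (p q : ℝ≥0∞) (hp : 0 < p) (hq : 0 < q) (s α β : ℝ)
    (hs : 0 < s) (hα : 0 < α) (hβ : 0 < β)
    (hdeg : sSup ((fun x : Euc d => s + β * ‖x‖ ^ α) '' unitCube d) < (m : ℝ)) :
    ∃ C : ℝ, 0 < C ∧ ∃ k₀ : ℕ, ∀ k : ℕ, k₀ ≤ k →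
      vBesovNorm p q (fun x : Euc d => s + β * ‖x‖ ^ α) (Mspline d m k 0) ≤
        ENNReal.ofReal (C * (2 : ℝ) ^ ((k : ℝ) * (s - (d : ℝ) / p.toReal))) := by
  
  set σ : Euc d → ℝ := fun x : Euc d => s + β * ‖x‖ ^ α with hσ
  set S : ℝ := sSup (σ '' unitCube d) with hS
  set r : ℕ := besovR σ with hr
  have hrS : S < r := by
    rw [hr, besovR]; push_cast; exact Nat.lt_floor_add_one _
  have hrm : r ≤ m := by
    rw [hr, besovR]
    exact (Nat.floor_lt' (by omega)).2 hdeg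
  have hσS : ∀ x ∈ unitCube d, σ x ≤ S := by
    intro x hx
    refine le_csSup ⟨s + β * (d * 1 : ℝ) ^ α, ?_⟩ ⟨x, hx, rfl⟩
    rintro _ ⟨y, hy, rfl⟩
    have := auxQ_norm 1 zero_le_one y (unitCube_eq d ▸ hy)
    simp only [hσ]
    gcongr
  obtain ⟨K₀, hK₀, hb⟩ := Mspline_diff d m r hm hrm
  set ρ : ℝ := 1 / p.toReal with hρ
  have hρ0 : 0 ≤ ρ := by positivity
  set K : ℝ := d * (m + 1) + r with hK
  have hK0 : 0 ≤ K := by positivity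
  set X : ℝ := Real.exp (β * K ^ α / α) with hX
  set c : ℝ := ((r + 1) * (m + 1) ^ d) ^ ρ with hc
  have hcpos : 0 < c := by positivity
  set J : ℝ := (1 / ((r - S) * q.toReal) + 1 / (s * q.toReal)) ^ (1 / q.toReal) + 1 with hJ
  have hδ : 0 < (r:ℝ) - S := by linarith
  have hJpos : 0 < J := by positivity
  refine ⟨K₀ * c + K₀ * X * c * J, by positivity, 0, fun k _ => ?_⟩
  set a : ℝ := ((2:ℝ) ^ k)⁻¹ with ha'
  have ha : 0 < a := by positivity
  have ha1 : a ≤ 1 := inv_le_one_of_one_le₀ (one_le_pow₀ (by norm_num))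
  have hZ : (2 : ℝ) ^ ((k : ℝ) * (s - (d : ℝ) / p.toReal)) = a ^ (-s) * a ^ (d * ρ) := by
    rw [← Real.rpow_add ha, ha', ← Real.rpow_natCast, ← Real.rpow_neg (by norm_num),
      ← Real.rpow_mul (by norm_num)]
    congr 1
    rw [hρ]; ring
  rw [hZ]
  have has : 1 ≤ a ^ (-s) := Real.one_le_rpow_of_pos_of_le_one_of_nonpos ha ha1 (by linarith)
  have hV : ((r + 1) * ((m + 1) * a) ^ d : ℝ) ^ ρ = c * a ^ (d * ρ) := by
    rw [mul_pow, ← mul_assoc, Real.mul_rpow (by positivity) (by positivity), Real.rpow_mul ha.le,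
      Real.rpow_natCast]
  have hL : eLpNorm (Mspline d m k 0) p (cubeMeasure d) ≤
      ENNReal.ofReal (K₀ * c * (a ^ (-s) * a ^ (d * ρ))) := by
    refine (aux_eLpNorm p _ (auxQ d ((m + 1) * a)) K₀ ((r + 1) * ((m + 1) * a) ^ d) hK₀.le
      (by positivity) ?_ (fun x _ => (hb k).1 x) ?_).trans ?_
    · rw [auxQ_volume d _ (by positivity)]
      refine ENNReal.ofReal_le_ofReal ?_
      exact le_mul_of_one_le_left (by positivity) (by linarith [(Nat.cast_nonneg r : (0:ℝ) ≤ r)])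
    · intro x hx
      by_contra h
      exact hx (Mspline_support d m k hm x h)
    · refine ENNReal.ofReal_le_ofReal ?_
      rw [hV, mul_assoc]
      gcongr
      exact le_mul_of_one_le_left (by positivity) has
  have hom : ∀ t, 0 < t → omegaStar p σ r (Mspline d m k 0) t ≤
      ENNReal.ofReal (K₀ * X * c * (a ^ (-s) * a ^ (d * ρ)) * auxg a (r - S) s t) := by
    intro t ht
    refine iSup₂_le fun h hh => ?_
    have hh' : ‖h‖ ≤ t := hh
    have hg := auxg_nonneg a (r - S) s t ha ht
    refine (aux_eLpNorm p _ (auxE r h ((m + 1) * a)) (K₀ * (X * a ^ (-s) * auxg a (r - S) s t))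
      ((r + 1) * ((m + 1) * a) ^ d) (by positivity)
      (by positivity) (auxE_volume r h _ (by positivity)) ?_ ?_).trans ?_
    · intro x hx
      rw [abs_mul, abs_of_nonneg (Real.rpow_nonneg ht.le _)]
      by_cases h0 : rDiff r h (Mspline d m k 0) x = 0
      · rw [h0, abs_zero, mul_zero]; positivity
      have hxE := rDiff_support d m k r hm h x h0
      have hxn := auxE_norm r h _ t (by positivity) hh' x hxE
      have hD : |rDiff r h (Mspline d m k 0) x| ≤ K₀ ∧
          |rDiff r h (Mspline d m k 0) x| ≤ K₀ * (t / a) ^ r := by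
        rw [rDiff_eq]
        split_ifs
        · refine ⟨((hb k).2 h x).1, ((hb k).2 h x).2.trans ?_⟩
          have : t / a = 2 ^ k * t := by rw [ha', div_inv_eq_mul, mul_comm]
          rw [this]
          gcongr
        · rw [abs_zero]; exact ⟨hK₀.le, by positivity⟩
      have := aux_point s α β K S r hs hα hβ hK0 a t ‖x‖
        (|rDiff r h (Mspline d m k 0) x| / K₀) ha ha1 ht (norm_nonneg _) (hσS x hx)
        (by
          refine hxn.trans ?_
          rw [hK, add_mul _ _ (max a t), ← mul_assoc, ← ha']
          gcongr
          · exact le_max_left _ _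
          · exact le_max_right _ _) (by positivity)
        ((div_le_one hK₀).2 hD.1) ((div_le_iff₀' hK₀).2 hD.2)
      calc _ = K₀ * (t ^ (-(s + β * ‖x‖ ^ α)) * (|rDiff r h (Mspline d m k 0) x| / K₀)) := by
            field_simp; rfl
        _ ≤ _ := mul_le_mul_of_nonneg_left this hK₀.le
    · intro x hx
      by_contra hne
      exact hx (rDiff_support d m k r hm h x (right_ne_zero_of_mul hne))
    · refine ENNReal.ofReal_le_ofReal (le_of_eq ?_)
      rw [hV]; ring
  have hsemi := aux_semi p q hq σ r (Mspline d m k 0) a (r - S) s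
    (K₀ * X * c * (a ^ (-s) * a ^ (d * ρ))) ha hδ hs (by positivity) hom
  refine (add_le_add hL hsemi).trans ?_
  rw [← ENNReal.ofReal_add (by positivity) (by positivity)]
  refine ENNReal.ofReal_le_ofReal (le_of_eq ?_)
  ring
end
end
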